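/- Let H be an infinite-dimensional separable complex Hilbert space and let T be a bounded linear operator on H. The following are equivalent: (a) T is essentially reductive and T has property (CR); (b) either (i) there exist λ, μ ∈ ℂ and a selfadjoint bounded operator R on H such that T = λ·R + μ·1, or (ii) there exist λ, μ ∈ ℂ and a unitary operator V on H with σ(V) ≠ {z ∈ ℂ : |z| = 1} such that T = λ·V + μ·1. -/

import Mathlib

open ContinuousLinearMap

/-- `P` is an orthogonal projection. -/
def IsOrthoProj {H : Type*} [NormedAddCommGroup H] [InnerProductSpace ℂ H]
    [CompleteSpace H] (P : H →L[ℂ] H) : Prop :=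
  P * P = P ∧ ContinuousLinearMap.adjoint P = P

/-- Property (CR): the two off-diagonal corners always have the same rank
(as a cardinal, the dimension of the range). -/
def HasCR {H : Type*} [NormedAddCommGroup H] [InnerProductSpace ℂ H]
    [CompleteSpace H] (T : H →L[ℂ] H) : Prop :=
  ∀ P : H →L[ℂ] H, IsOrthoProj P →
    LinearMap.rank ((P * T * (1 - P) : H →L[ℂ] H) : H →ₗ[ℂ] H) =
    LinearMap.rank (((1 - P) * T * P : H →L[ℂ] H) : H →ₗ[ℂ] H)

/-- `T` is essentially reductive: one off-diagonal corner is compact iff the other is. -/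
def EssentiallyReductive {H : Type*} [NormedAddCommGroup H] [InnerProductSpace ℂ H]
    [CompleteSpace H] (T : H →L[ℂ] H) : Prop :=
  ∀ P : H →L[ℂ] H, IsOrthoProj P →
    (IsCompactOperator ⇑(P * T * (1 - P)) ↔ IsCompactOperator ⇑((1 - P) * T * P))

set_option linter.unusedSectionVars false

section HilbertSpaceLemmas

variable {H : Type*} [NormedAddCommGroup H] [InnerProductSpace ℂ H] [CompleteSpace H]

open scoped InnerProductSpace

/-- The rank of a bounded operator, as a cardinal. -/
noncomputable def opRank (A : H →L[ℂ] H) : Cardinal := LinearMap.rank (A : H →ₗ[ℂ] H)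

theorem opRank_mul_le_left (A B : H →L[ℂ] H) : opRank (A * B) ≤ opRank A :=
  LinearMap.rank_comp_le_left (B : H →ₗ[ℂ] H) (A : H →ₗ[ℂ] H)

theorem opRank_mul_le_right (A B : H →L[ℂ] H) : opRank (A * B) ≤ opRank B :=
  LinearMap.rank_comp_le_right (B : H →ₗ[ℂ] H) (A : H →ₗ[ℂ] H)

theorem opRank_zero : opRank (0 : H →L[ℂ] H) = 0 :=
  LinearMap.rank_zero

theorem opRank_eq_zero {A : H →L[ℂ] H} (h : opRank A = 0) : A = 0 := by
  have h1 : LinearMap.range (A : H →ₗ[ℂ] H) = ⊥ := Submodule.rank_eq_zero.1 h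
  ext x
  have : A x ∈ LinearMap.range (A : H →ₗ[ℂ] H) := ⟨x, rfl⟩
  rw [h1] at this
  simpa using this

theorem opRank_isUnit_mul {U : H →L[ℂ] H} (hU : IsUnit U) (A : H →L[ℂ] H) :
    opRank (U * A) = opRank A := by
  obtain ⟨u, rfl⟩ := hU
  refine le_antisymm (opRank_mul_le_right _ _) ?_
  simpa using opRank_mul_le_right (↑u⁻¹ : H →L[ℂ] H) (↑u * A)

theorem opRank_mul_isUnit {U : H →L[ℂ] H} (hU : IsUnit U) (A : H →L[ℂ] H) :
    opRank (A * U) = opRank A := by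
  obtain ⟨u, rfl⟩ := hU
  refine le_antisymm (opRank_mul_le_left _ _) ?_
  simpa [mul_assoc] using opRank_mul_le_left (A * (u : H →L[ℂ] H)) (↑u⁻¹ : H →L[ℂ] H)

theorem isUnit_algebraMap_op {c : ℂ} (hc : c ≠ 0) : IsUnit (c • (1 : H →L[ℂ] H)) := by
  rw [← Algebra.algebraMap_eq_smul_one]
  exact (isUnit_iff_ne_zero.2 hc).map (algebraMap ℂ (H →L[ℂ] H))

theorem opRank_smul {c : ℂ} (hc : c ≠ 0) (A : H →L[ℂ] H) : opRank (c • A) = opRank A := by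
  simpa using opRank_isUnit_mul (isUnit_algebraMap_op hc) A

theorem opRank_neg (A : H →L[ℂ] H) : opRank (-A) = opRank A := by
  simpa using opRank_smul (H := H) (c := -1) (by simp) A

theorem inner_star_right (A : H →L[ℂ] H) (x y : H) : ⟪x, star A y⟫_ℂ = ⟪A x, y⟫_ℂ :=
  ContinuousLinearMap.adjoint_inner_right A x y

theorem inner_star_left (A : H →L[ℂ] H) (x y : H) : ⟪star A x, y⟫_ℂ = ⟪x, A y⟫_ℂ :=
  ContinuousLinearMap.adjoint_inner_left A y x

theorem norm_star_apply_sq_le (A : H →L[ℂ] H) (x : H) :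
    ‖star A x‖ ^ 2 ≤ ‖A (star A x)‖ * ‖x‖ := by
  have h : ((‖star A x‖ : ℂ)) ^ 2 = ⟪A (star A x), x⟫_ℂ := by
    rw [← inner_star_right, inner_self_eq_norm_sq_to_K]; rfl
  calc ‖star A x‖ ^ 2 = ‖⟪A (star A x), x⟫_ℂ‖ := by rw [← h]; simp
    _ ≤ _ := norm_inner_le_norm _ _

theorem opRank_star_le (A : H →L[ℂ] H) : opRank (star A) ≤ opRank A := by
  let f : LinearMap.range ((star A : H →L[ℂ] H) : H →ₗ[ℂ] H) →ₗ[ℂ]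
      LinearMap.range (A : H →ₗ[ℂ] H) :=
    ((A : H →ₗ[ℂ] H).comp (Submodule.subtype _)).codRestrict _ fun x => ⟨x, rfl⟩
  refine LinearMap.rank_le_of_injective f ?_
  rw [injective_iff_map_eq_zero]
  rintro ⟨_, x, rfl⟩ hx
  have hx' : A (star A x) = 0 := congrArg Subtype.val hx
  have := norm_star_apply_sq_le A x
  rw [hx'] at this
  have h0 : ‖star A x‖ = 0 := by
    have := norm_nonneg (star A x)
    simp_all
  exact Subtype.ext (norm_eq_zero.1 h0)

theorem opRank_star (A : H →L[ℂ] H) : opRank (star A) = opRank A :=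
  le_antisymm (opRank_star_le A) (by simpa using opRank_star_le (star A))

theorem IsCompactOperator.mul_left_clm {A : H →L[ℂ] H} (hA : IsCompactOperator ⇑A)
    (B : H →L[ℂ] H) : IsCompactOperator ⇑(B * A) :=
  hA.clm_comp B

theorem IsCompactOperator.mul_right_clm {A : H →L[ℂ] H} (hA : IsCompactOperator ⇑A)
    (B : H →L[ℂ] H) : IsCompactOperator ⇑(A * B) :=
  hA.comp_clm B

theorem isCompactOperator_isUnit_mul {U : H →L[ℂ] H} (hU : IsUnit U) (A : H →L[ℂ] H) :
    IsCompactOperator ⇑(U * A) ↔ IsCompactOperator ⇑A := by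
  obtain ⟨u, rfl⟩ := hU
  refine ⟨fun h => ?_, fun h => h.mul_left_clm _⟩
  simpa using h.mul_left_clm (↑u⁻¹ : H →L[ℂ] H)

theorem isCompactOperator_mul_isUnit {U : H →L[ℂ] H} (hU : IsUnit U) (A : H →L[ℂ] H) :
    IsCompactOperator ⇑(A * U) ↔ IsCompactOperator ⇑A := by
  obtain ⟨u, rfl⟩ := hU
  refine ⟨fun h => ?_, fun h => h.mul_right_clm _⟩
  simpa [mul_assoc] using h.mul_right_clm (↑u⁻¹ : H →L[ℂ] H)

theorem isCompactOperator_smul_clm {c : ℂ} (hc : c ≠ 0) (A : H →L[ℂ] H) :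
    IsCompactOperator ⇑(c • A) ↔ IsCompactOperator ⇑A := by
  simpa using isCompactOperator_isUnit_mul (isUnit_algebraMap_op hc) A

theorem isCompactOperator_neg_clm (A : H →L[ℂ] H) :
    IsCompactOperator ⇑(-A) ↔ IsCompactOperator ⇑A := by
  simpa using isCompactOperator_smul_clm (H := H) (c := -1) (by simp) A

/-- Schauder's theorem on a Hilbert space. -/
theorem IsCompactOperator.star_clm {A : H →L[ℂ] H} (hA : IsCompactOperator ⇑A) :
    IsCompactOperator ⇑(star A) := by
  have hAA : IsCompactOperator ⇑(A * star A) := hA.mul_right_clm _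
  have hK : TotallyBounded (⇑(A * star A) '' Metric.ball (0 : H) 1) :=
    ((IsCompactOperator.isCompact_closure_image_ball
      (f := (A * star A : H →L[ℂ] H).toLinearMap) hAA 1).totallyBounded).subset subset_closure
  refine (isCompactOperator_iff_isCompact_closure_image_ball
    (star A : H →L[ℂ] H).toLinearMap zero_lt_one).2 ?_
  refine TotallyBounded.isCompact_of_isClosed (TotallyBounded.closure ?_) isClosed_closure
  rw [Metric.totallyBounded_iff]
  intro ε hε
  obtain ⟨t, hts, htf, htc⟩ := Metric.finite_approx_of_totallyBounded hK (ε ^ 2 / 4) (by positivity)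
  have hz : ∀ y, ∃ z, y ∈ t → z ∈ Metric.ball (0 : H) 1 ∧ (A * star A) z = y := by
    intro y
    by_cases hy : y ∈ t
    · obtain ⟨z, hz⟩ := hts hy
      exact ⟨z, fun _ => hz⟩
    · exact ⟨0, fun h => absurd h hy⟩
  choose z hz using hz
  refine ⟨(fun y => star A (z y)) '' t, htf.image _, ?_⟩
  rintro _ ⟨x, hx, rfl⟩
  obtain ⟨y, hy, hxy⟩ := Set.mem_iUnion₂.1 (htc ⟨x, hx, rfl⟩)
  refine Set.mem_iUnion₂.2 ⟨_, ⟨y, hy, rfl⟩, ?_⟩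
  obtain ⟨hzb, hzy⟩ := hz y hy
  rw [Metric.mem_ball, ← hzy, dist_eq_norm, ← map_sub] at hxy
  rw [Metric.mem_ball, dist_eq_norm]
  change ‖star A x - star A (z y)‖ < ε
  rw [← map_sub]
  have h1 := norm_star_apply_sq_le A (x - z y)
  have h2 : ‖x - z y‖ < 2 := by
    have := norm_sub_le x (z y)
    rw [mem_ball_zero_iff] at hx hzb
    linarith
  have h3 : ‖A (star A (x - z y))‖ < ε ^ 2 / 4 := hxy
  have h4 : ‖star A (x - z y)‖ ^ 2 < ε ^ 2 := by
    nlinarith [norm_nonneg (x - z y), norm_nonneg (A (star A (x - z y))), sq_pos_of_pos hε]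
  exact lt_of_pow_lt_pow_left₀ 2 hε.le h4

theorem isCompactOperator_star_iff (A : H →L[ℂ] H) :
    IsCompactOperator ⇑(star A) ↔ IsCompactOperator ⇑A :=
  ⟨fun h => by simpa using h.star_clm, fun h => h.star_clm⟩

theorem isUnit_of_coercive {A : H →L[ℂ] H} {c : ℝ} (hc : 0 < c)
    (h : ∀ x, c * ‖x‖ ^ 2 ≤ (⟪A x, x⟫_ℂ).re) : IsUnit A := by
  refine ContinuousLinearMap.isUnit_of_forall_le_norm_inner_map A (c := ⟨c, hc.le⟩) hc fun x => ?_
  calc ‖x‖ ^ 2 * c = c * ‖x‖ ^ 2 := mul_comm _ _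
    _ ≤ (⟪A x, x⟫_ℂ).re := h x
    _ ≤ _ := Complex.re_le_norm _

/-- A pair of complementary orthogonal projections. -/
structure ComplProj (P Q : H →L[ℂ] H) : Prop where
  left_idem : P * P = P
  right_idem : Q * Q = Q
  mul_right : P * Q = 0
  mul_left : Q * P = 0
  add_eq : P + Q = 1
  star_left : star P = P
  star_right : star Q = Q

theorem ComplProj.symm {P Q : H →L[ℂ] H} (h : ComplProj P Q) : ComplProj Q P :=
  ⟨h.right_idem, h.left_idem, h.mul_left, h.mul_right, by rw [add_comm, h.add_eq],
    h.star_right, h.star_left⟩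

theorem IsOrthoProj.complProj {P : H →L[ℂ] H} (h : IsOrthoProj P) : ComplProj P (1 - P) := by
  obtain ⟨h1, h2⟩ := h
  have h2 : star P = P := h2
  refine ⟨h1, ?_, ?_, ?_, by abel, h2, by simp [h2]⟩ <;> simp [mul_sub, sub_mul, h1]

theorem ComplProj.norm_sq {P Q : H →L[ℂ] H} (h : ComplProj P Q) (x : H) :
    ‖x‖ ^ 2 = ‖P x‖ ^ 2 + ‖Q x‖ ^ 2 := by
  have hx : x = P x + Q x := by rw [← add_apply, h.add_eq]; rfl
  have h0 : ⟪P x, Q x⟫_ℂ = 0 := by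
    rw [← inner_star_right, h.star_left]
    change ⟪x, (P * Q) x⟫_ℂ = 0
    rw [h.mul_right]; simp
  conv_lhs => rw [hx]
  have := norm_add_sq_eq_norm_sq_add_norm_sq_of_inner_eq_zero (P x) (Q x) h0
  nlinarith

/-- The compression of a coercive operator, extended by the identity, is invertible. -/
theorem ComplProj.isUnit_compression {P Q : H →L[ℂ] H} (h : ComplProj P Q) {S : H →L[ℂ] H}
    {c : ℝ} (hc : 0 < c) (hS : ∀ x, c * ‖x‖ ^ 2 ≤ (⟪S x, x⟫_ℂ).re) : IsUnit (P * S * P + Q) := by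
  refine isUnit_of_coercive (c := min c 1) (lt_min hc one_pos) fun x => ?_
  have h1 : ⟪(P * S * P + Q) x, x⟫_ℂ = ⟪S (P x), P x⟫_ℂ + ⟪Q x, Q x⟫_ℂ := by
    rw [add_apply, inner_add_left]
    congr 1
    · change ⟪P (S (P x)), x⟫_ℂ = _
      rw [← inner_star_right, h.star_left]
    · conv_lhs => rw [← h.right_idem]
      change ⟪Q (Q x), x⟫_ℂ = _
      rw [← inner_star_right, h.star_right]
  rw [h1, Complex.add_re, h.norm_sq x, inner_self_eq_norm_sq_to_K]
  have h2 := hS (P x)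
  have h3 : (((‖Q x‖ : ℂ)) ^ 2).re = ‖Q x‖ ^ 2 := by
    rw [← Complex.ofReal_pow, Complex.ofReal_re]
  have h4 : min c 1 * ‖P x‖ ^ 2 ≤ c * ‖P x‖ ^ 2 := by gcongr; exact min_le_left _ _
  have h5 : min c 1 * ‖Q x‖ ^ 2 ≤ 1 * ‖Q x‖ ^ 2 := by gcongr; exact min_le_right _ _
  have h6 : ((‖Q x‖ : ℂ) ^ 2).re + (⟪S (P x), P x⟫_ℂ).re =
    ‖Q x‖ ^ 2 + (⟪S (P x), P x⟫_ℂ).re := by rw [h3]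
  change _ ≤ (⟪S (P x), P x⟫_ℂ).re + ((‖Q x‖ : ℂ) ^ 2).re
  linarith

/-- The corners of an operator and of its inverse agree up to invertible factors, when
both are coercive. -/
theorem ComplProj.exists_isUnit_corner {P Q : H →L[ℂ] H} (h : ComplProj P Q) {S X : H →L[ℂ] H}
    {c d : ℝ} (hc : 0 < c) (hS : ∀ x, c * ‖x‖ ^ 2 ≤ (⟪S x, x⟫_ℂ).re)
    (hd : 0 < d) (hX : ∀ x, d * ‖x‖ ^ 2 ≤ (⟪X x, x⟫_ℂ).re) (hSX : S * X = 1) :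
    ∃ U W : H →L[ℂ] H, IsUnit U ∧ IsUnit W ∧ U * (P * X * Q) = -(P * S * Q) * W := by
  refine ⟨P * S * P + Q, Q * X * Q + P, h.isUnit_compression hc hS,
    h.symm.isUnit_compression hd hX, ?_⟩
  have e1 : P * (S * X) * Q = 0 := by rw [hSX, mul_one, h.mul_right]
  have e2 : P * S * (P + Q) * X * Q = 0 := by rw [h.add_eq, mul_one, ← e1]; noncomm_ring
  have l1 : (P * S * P + Q) * (P * X * Q) = P * S * (P * P) * X * Q + (Q * P) * X * Q := by
    noncomm_ring
  have l2 : -(P * S * Q) * (Q * X * Q + P) = -(P * S * (Q * Q) * X * Q) - P * S * (Q * P) := by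
    noncomm_ring
  rw [l1, l2, h.left_idem, h.right_idem, h.mul_left]
  have e3 : P * S * P * X * Q + P * S * Q * X * Q = 0 := by rw [← e2]; noncomm_ring
  simp only [zero_mul, mul_zero, add_zero, sub_zero]
  exact eq_neg_of_add_eq_zero_left e3

theorem ComplProj.corner_star {P Q : H →L[ℂ] H} (h : ComplProj P Q) (T : H →L[ℂ] H) :
    star (P * T * Q) = Q * star T * P := by
  simp [star_mul, h.star_left, h.star_right, mul_assoc]

theorem star_eq_cayley {X S : H →L[ℂ] H} (hX : X + star X = star X * X)
    (hXS : X * S = 1) : S + star S = 1 := by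
  have h1 : star S * star X = 1 := by rw [← star_mul, hXS, star_one]
  calc S + star S = (star S * star X) * S + star S * (X * S) := by rw [h1, hXS]; simp
    _ = star S * (X + star X) * S := by noncomm_ring
    _ = (star S * star X) * (X * S) := by rw [hX]; noncomm_ring
    _ = 1 := by rw [h1, hXS, one_mul]

theorem unitary_corners {V : H →L[ℂ] H} (hV : star V * V = 1) (h1 : IsUnit (1 - V))
    {P : H →L[ℂ] H} (hP : IsOrthoProj P) :
    opRank (P * V * (1 - P)) = opRank ((1 - P) * V * P) ∧
    (IsCompactOperator ⇑(P * V * (1 - P)) ↔ IsCompactOperator ⇑((1 - P) * V * P)) := by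
  set Q := 1 - P with hQ
  have h : ComplProj P Q := hP.complProj
  clear_value Q
  obtain ⟨u, hu⟩ := h1
  set X := 1 - V with hXdef
  set S : H →L[ℂ] H := ↑u⁻¹ with hSdef
  have hXS : X * S = 1 := by rw [← hu, hSdef]; simp
  have hSX : S * X = 1 := by rw [← hu, hSdef]; simp
  have hXX : X + star X = star X * X := by
    rw [hXdef, star_sub, star_one, show (1 - star V) * (1 - V) = 1 - V - star V + star V * V by noncomm_ring, hV]
    abel
  have hSS : S + star S = 1 := star_eq_cayley hXX hXS
  have key : ∀ x, (⟪X x, x⟫_ℂ).re = 1 / 2 * ‖X x‖ ^ 2 := by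
    intro x
    have e1 : ⟪X x, X x⟫_ℂ = ⟪X x, x⟫_ℂ + ⟪x, X x⟫_ℂ := by
      rw [← inner_star_left X x x, ← inner_add_left, ← inner_star_left X (X x) x]
      change _ = ⟪(X + star X) x, x⟫_ℂ
      rw [hXX]; rfl
    have e2 : (⟪x, X x⟫_ℂ).re = (⟪X x, x⟫_ℂ).re := by
      rw [← inner_conj_symm, Complex.conj_re]
    have e3 : (⟪X x, X x⟫_ℂ).re = ‖X x‖ ^ 2 := by
      rw [inner_self_eq_norm_sq_to_K]
      change ((‖X x‖ : ℂ) ^ 2).re = _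
      rw [← Complex.ofReal_pow, Complex.ofReal_re]
    rw [e1, Complex.add_re, e2] at e3
    linarith
  have hScoer : ∀ x, 1 / 2 * ‖x‖ ^ 2 ≤ (⟪S x, x⟫_ℂ).re := by
    intro x
    have e1 : X (S x) = x := by change (X * S) x = x; rw [hXS]; rfl
    have e2 := key (S x)
    rw [e1] at e2
    rw [← e2, ← inner_conj_symm, Complex.conj_re]
  have hXcoer : ∀ x, 1 / (2 * (‖S‖ ^ 2 + 1)) * ‖x‖ ^ 2 ≤ (⟪X x, x⟫_ℂ).re := by
    intro x
    have e1 : S (X x) = x := by change (S * X) x = x; rw [hSX]; rfl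
    have e2 : ‖x‖ ≤ ‖S‖ * ‖X x‖ := by simpa [e1] using S.le_opNorm (X x)
    rw [key x, div_mul_eq_mul_div, div_le_iff₀ (by positivity)]
    have e3 : ‖x‖ ^ 2 ≤ (‖S‖ * ‖X x‖) ^ 2 := by gcongr
    nlinarith [sq_nonneg ‖X x‖]
  obtain ⟨U₁, W₁, hU₁, hW₁, e₁⟩ :=
    h.exists_isUnit_corner (by norm_num) hScoer (by positivity) hXcoer hSX
  obtain ⟨U₂, W₂, hU₂, hW₂, e₂⟩ :=
    h.symm.exists_isUnit_corner (by norm_num) hScoer (by positivity) hXcoer hSX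
  have c1 : P * X * Q = -(P * V * Q) := by
    rw [hXdef, mul_sub, mul_one, sub_mul, h.mul_right, zero_sub]
  have c2 : Q * X * P = -(Q * V * P) := by
    rw [hXdef, mul_sub, mul_one, sub_mul, h.mul_left, zero_sub]
  have c3 : Q * S * P = -star (P * S * Q) := by
    rw [h.corner_star, eq_neg_iff_add_eq_zero, ← add_mul, ← mul_add, hSS, mul_one, h.mul_left]
  rw [c1] at e₁
  rw [c2, c3] at e₂
  constructor
  · rw [← opRank_neg, ← opRank_isUnit_mul hU₁, e₁, opRank_mul_isUnit hW₁, opRank_neg,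
      ← opRank_neg (Q * V * P), ← opRank_isUnit_mul hU₂ (-(Q * V * P)), e₂, opRank_mul_isUnit hW₂, neg_neg,
      opRank_star]
  · rw [← isCompactOperator_neg_clm, ← isCompactOperator_isUnit_mul hU₁, e₁,
      isCompactOperator_mul_isUnit hW₁, isCompactOperator_neg_clm,
      ← isCompactOperator_neg_clm (Q * V * P), ← isCompactOperator_isUnit_mul hU₂ (-(Q * V * P)), e₂,
      isCompactOperator_mul_isUnit hW₂, neg_neg, isCompactOperator_star_iff]

theorem corner_smul_add (P R : H →L[ℂ] H) (hP : P * P = P) (a b : ℂ) :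
    P * (a • R + b • 1) * (1 - P) = a • (P * R * (1 - P)) := by
  have : P * (1 - P) = 0 := by rw [mul_sub, hP, mul_one, sub_self]
  simp [mul_add, add_mul, this]

theorem corner_smul_add' (P R : H →L[ℂ] H) (hP : P * P = P) (a b : ℂ) :
    (1 - P) * (a • R + b • 1) * P = a • ((1 - P) * R * P) := by
  have : (1 - P) * P = 0 := by rw [sub_mul, hP, one_mul, sub_self]
  simp [mul_add, add_mul, this]

/-- Both properties are inherited by affine functions of an operator. -/
theorem essentiallyReductive_and_hasCR_of_corners {R : H →L[ℂ] H} (a b : ℂ)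
    (h : ∀ P : H →L[ℂ] H, IsOrthoProj P →
      opRank (P * R * (1 - P)) = opRank ((1 - P) * R * P) ∧
      (IsCompactOperator ⇑(P * R * (1 - P)) ↔ IsCompactOperator ⇑((1 - P) * R * P))) :
    EssentiallyReductive (a • R + b • 1) ∧ HasCR (a • R + b • 1) := by
  constructor
  · intro P hP
    rw [corner_smul_add P R hP.1, corner_smul_add' P R hP.1]
    rcases eq_or_ne a 0 with rfl | ha
    · simp only [zero_smul]
    · rw [isCompactOperator_smul_clm ha, isCompactOperator_smul_clm ha]
      exact (h P hP).2
  · intro P hP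
    rw [corner_smul_add P R hP.1, corner_smul_add' P R hP.1]
    rcases eq_or_ne a 0 with rfl | ha
    · simp only [zero_smul]
    · exact (opRank_smul ha _).trans ((h P hP).1.trans (opRank_smul ha _).symm)

theorem selfAdjoint_corners {R : H →L[ℂ] H} (hR : star R = R)
    {P : H →L[ℂ] H} (hP : IsOrthoProj P) :
    opRank (P * R * (1 - P)) = opRank ((1 - P) * R * P) ∧
    (IsCompactOperator ⇑(P * R * (1 - P)) ↔ IsCompactOperator ⇑((1 - P) * R * P)) := by
  have h := hP.complProj.corner_star R
  rw [hR] at h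
  rw [← h, opRank_star, isCompactOperator_star_iff]
  exact ⟨rfl, Iff.rfl⟩

theorem essentiallyReductive_and_hasCR_of_unitary {V : H →L[ℂ] H} (hV : star V * V = 1)
    (hV' : V * star V = 1) (hσ : spectrum ℂ V ≠ {z : ℂ | ‖z‖ = 1}) (a b : ℂ) :
    EssentiallyReductive (a • V + b • 1) ∧ HasCR (a • V + b • 1) := by
  have hsub : spectrum ℂ V ⊆ {z : ℂ | ‖z‖ = 1} := by
    intro z hz
    simpa using spectrum.subset_circle_of_unitary (Unitary.mem_iff.2 ⟨hV, hV'⟩) hz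
  obtain ⟨α, hα, hαV⟩ := Set.exists_of_ssubset (hsub.ssubset_of_ne hσ)
  have hα0 : α ≠ 0 := by
    rintro rfl
    simp at hα
  have hα1 : star α * α = 1 := by
    have h1 : ‖α‖ = 1 := hα
    rw [Complex.star_def, ← Complex.normSq_eq_conj_mul_self, Complex.normSq_eq_norm_sq, h1]
    simp
  have hαα : α⁻¹ = star α := (eq_inv_of_mul_eq_one_left hα1).symm
  set V₁ := α⁻¹ • V with hV₁
  have hVV : V = α • V₁ := by rw [hV₁, smul_smul, mul_inv_cancel₀ hα0, one_smul]
  have h1 : star V₁ * V₁ = 1 := by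
    rw [hV₁, star_smul, smul_mul_smul_comm, hV, hαα, star_star, mul_comm, hα1, one_smul]
  have h2 : IsUnit (1 - V₁) := by
    have h3 : IsUnit (algebraMap ℂ (H →L[ℂ] H) α - V) := spectrum.notMem_iff.1 hαV
    have h4 : 1 - V₁ = (α⁻¹ • (1 : H →L[ℂ] H)) * (algebraMap ℂ (H →L[ℂ] H) α - V) := by
      rw [smul_mul_assoc, one_mul, smul_sub, Algebra.algebraMap_eq_smul_one, smul_smul,
        inv_mul_cancel₀ hα0, one_smul]
    rw [h4]
    exact (isUnit_algebraMap_op (inv_ne_zero hα0)).mul h3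
  rw [hVV, smul_smul]
  exact essentiallyReductive_and_hasCR_of_corners _ _ fun P hP => unitary_corners h1 h2 hP

end HilbertSpaceLemmas

section LocalDependence

variable {H : Type*} [NormedAddCommGroup H] [InnerProductSpace ℂ H] [CompleteSpace H]

open scoped InnerProductSpace

/-- The space of finite-rank operators. -/
def finRk (H : Type*) [NormedAddCommGroup H] [InnerProductSpace ℂ H] [CompleteSpace H] :
    Submodule ℂ (H →L[ℂ] H) where
  carrier := {A | FiniteDimensional ℂ (LinearMap.range (A : H →ₗ[ℂ] H))}
  zero_mem' := by
    change FiniteDimensional ℂ (LinearMap.range (0 : H →ₗ[ℂ] H))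
    rw [LinearMap.range_zero]
    infer_instance
  add_mem' := by
    intro A B hA hB
    have hA : FiniteDimensional ℂ (LinearMap.range (A : H →ₗ[ℂ] H)) := hA
    have hB : FiniteDimensional ℂ (LinearMap.range (B : H →ₗ[ℂ] H)) := hB
    refine Submodule.finiteDimensional_of_le
      (S₂ := LinearMap.range (A : H →ₗ[ℂ] H) ⊔ LinearMap.range (B : H →ₗ[ℂ] H)) ?_
    rintro _ ⟨x, rfl⟩
    exact Submodule.add_mem_sup ⟨x, rfl⟩ ⟨x, rfl⟩
  smul_mem' := by
    intro c A hA
    have hA : FiniteDimensional ℂ (LinearMap.range (A : H →ₗ[ℂ] H)) := hA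
    refine Submodule.finiteDimensional_of_le (S₂ := LinearMap.range (A : H →ₗ[ℂ] H)) ?_
    rintro _ ⟨x, rfl⟩
    exact Submodule.smul_mem _ c ⟨x, rfl⟩

theorem mem_finRk {A : H →L[ℂ] H} :
    A ∈ finRk H ↔ FiniteDimensional ℂ (LinearMap.range (A : H →ₗ[ℂ] H)) := Iff.rfl

theorem mem_finRk_of_forall {A : H →L[ℂ] H} (L : Submodule ℂ H) [FiniteDimensional ℂ L]
    (h : ∀ x, A x ∈ L) : A ∈ finRk H := by
  refine mem_finRk.2 (Submodule.finiteDimensional_of_le (S₂ := L) ?_)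
  rintro _ ⟨x, rfl⟩
  exact h x

theorem mem_finRk_iff_opRank {A : H →L[ℂ] H} : A ∈ finRk H ↔ opRank A < Cardinal.aleph0 :=
  Module.rank_lt_aleph0_iff.symm

theorem finRk_mul_right {A : H →L[ℂ] H} (hA : A ∈ finRk H) (B : H →L[ℂ] H) : A * B ∈ finRk H :=
  mem_finRk_iff_opRank.2 ((opRank_mul_le_left _ _).trans_lt (mem_finRk_iff_opRank.1 hA))

theorem star_mem_finRk {A : H →L[ℂ] H} (hA : A ∈ finRk H) : star A ∈ finRk H :=
  mem_finRk_iff_opRank.2 ((opRank_star A).trans_lt (mem_finRk_iff_opRank.1 hA))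

/-- Operators that are linearly independent modulo the finite-rank ones are linearly independent
at some vector. -/
theorem exists_linearIndependent_apply {n : ℕ} (A : Fin n → H →L[ℂ] H)
    (hA : ∀ c : Fin n → ℂ, ∑ i, c i • A i ∈ finRk H → c = 0) {G : H →L[ℂ] H} (hG : G ≠ 0) :
    ∃ x, G x ≠ 0 ∧ LinearIndependent ℂ fun i => A i x := by
  induction n with
  | zero =>
    obtain ⟨x, hx⟩ : ∃ x, G x ≠ 0 := by
      by_contra! h
      exact hG (by ext x; simpa using h x)
    exact ⟨x, hx, linearIndependent_empty_type⟩
  | succ n ih =>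
    obtain ⟨x₀, hGx, hx₀⟩ := ih (fun i => A i.castSucc) (by
      intro c hc
      have := hA (Fin.snoc c 0) (by simpa [Fin.sum_univ_castSucc] using hc)
      ext i
      simpa using congrFun this i.castSucc)
    by_cases hlast : A (Fin.last n) x₀ ∈
        Submodule.span ℂ (Set.range fun i : Fin n => A i.castSucc x₀)
    swap
    · exact ⟨x₀, hGx, linearIndependent_finSucc'.2 ⟨hx₀, hlast⟩⟩
    obtain ⟨c, hc⟩ := (Submodule.mem_span_range_iff_exists_fun ℂ).1 hlast
    set D : H →L[ℂ] H := A (Fin.last n) - ∑ i : Fin n, c i • A i.castSucc with hD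
    have hDx₀ : D x₀ = 0 := by simp [hD, ← hc]
    have hDA : ∀ x, D x = A (Fin.last n) x - ∑ i : Fin n, c i • A i.castSucc x := by
      intro x; simp [hD]
    obtain ⟨y, hy⟩ : ∃ y, D y ∉ Submodule.span ℂ (Set.range fun i : Fin n => A i.castSucc x₀) := by
      by_contra! h
      have : FiniteDimensional ℂ (Submodule.span ℂ (Set.range fun i : Fin n => A i.castSucc x₀)) :=
        FiniteDimensional.span_of_finite ℂ (Set.finite_range _)
      have h1 : D ∈ finRk H := mem_finRk_of_forall _ h
      have h2 := hA (Fin.snoc (-c) 1) (by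
        convert h1 using 1
        simp [Fin.sum_univ_castSucc, hD]; abel)
      simpa using congrFun h2 (Fin.last n)
    let F : ℂ → Fin (n + 1) → H := fun t =>
      Fin.snoc (α := fun _ => H) (fun i : Fin n => A i.castSucc (x₀ + t • y)) (D y)
    have hF : Continuous F := by
      refine continuous_pi fun i => ?_
      refine Fin.lastCases ?_ (fun i => ?_) i
      · simp only [F, Fin.snoc_last]; fun_prop
      · simp only [F, Fin.snoc_castSucc]; fun_prop
    have h0 : F 0 ∈ {f : Fin (n + 1) → H | LinearIndependent ℂ f} := by
      refine linearIndependent_finSucc'.2 ?_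
      simpa [F] using ⟨hx₀, hy⟩
    have e1 : ∀ᶠ t in nhds (0 : ℂ), LinearIndependent ℂ (F t) :=
      hF.continuousAt.preimage_mem_nhds (isOpen_setOfPred_linearIndependent.mem_nhds h0)
    have e2 : ∀ᶠ t in nhds (0 : ℂ), G (x₀ + t • y) ≠ 0 := by
      have : Continuous fun t : ℂ => G (x₀ + t • y) := by fun_prop
      exact this.continuousAt.eventually_ne (by simpa using hGx)
    have e3 : ∀ᶠ t in nhdsWithin (0 : ℂ) {0}ᶜ, t ≠ 0 := self_mem_nhdsWithin
    obtain ⟨t, ⟨h1, h2⟩, h3⟩ :=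
      (((e1.and e2).filter_mono nhdsWithin_le_nhds).and e3).exists
    refine ⟨x₀ + t • y, h2, linearIndependent_finSucc'.2 ?_⟩
    obtain ⟨h4, h5⟩ := linearIndependent_finSucc'.1 h1
    simp only [F, Fin.init_snoc, Fin.snoc_last] at h4 h5
    refine ⟨h4, fun h6 => h5 ?_⟩
    have h7 : D y = t⁻¹ • D (x₀ + t • y) := by
      rw [map_add, hDx₀, zero_add, map_smul, smul_smul, inv_mul_cancel₀ h3, one_smul]
    rw [h7, hDA]
    refine Submodule.smul_mem _ _ (Submodule.sub_mem _ h6 ?_)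
    exact Submodule.sum_mem _ fun i _ => Submodule.smul_mem _ _ (Submodule.subset_span ⟨i, rfl⟩)

/-- A strengthening of `exists_linearIndependent_apply`, modulo the range of a finite-rank
operator. -/
theorem exists_linearIndependent_apply_mod {n : ℕ} (A : Fin n → H →L[ℂ] H)
    (hA : ∀ c : Fin n → ℂ, ∑ i, c i • A i ∈ finRk H → c = 0) {F : H →L[ℂ] H} (hF : F ∈ finRk H)
    {G : H →L[ℂ] H} (hG : G ≠ 0) :
    ∃ x, G x ≠ 0 ∧ ∀ (c : Fin n → ℂ) (z : H), ∑ i, c i • A i x = F z → c = 0 := by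
  have hF' : FiniteDimensional ℂ (LinearMap.range (F : H →ₗ[ℂ] H)) := hF
  set P := (LinearMap.range (F : H →ₗ[ℂ] H)).starProjection with hP
  have hPf : P ∈ finRk H :=
    mem_finRk_of_forall _ fun x => Submodule.starProjection_apply_mem _ x
  obtain ⟨x, hx, hli⟩ := exists_linearIndependent_apply (fun i => (1 - P) * A i) (by
    intro c hc
    refine hA c ?_
    have : ∑ i, c i • A i = P * (∑ i, c i • A i) + ∑ i, c i • ((1 - P) * A i) := by
      simp [Finset.mul_sum, sub_mul, smul_sub, Finset.sum_sub_distrib]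
    rw [this]
    exact add_mem (finRk_mul_right hPf _) hc) hG
  refine ⟨x, hx, fun c z hc => ?_⟩
  ext i
  refine Fintype.linearIndependent_iff.1 hli c ?_ i
  have h1 : P (F z) = F z := Submodule.starProjection_eq_self_iff.2 ⟨z, rfl⟩
  have h2 : ∑ i, c i • ((1 - P) * A i) x = (1 - P) (∑ i, c i • A i x) := by simp
  rw [h2, hc]
  simp [h1]

end LocalDependence

section RankConsequences

variable {H : Type*} [NormedAddCommGroup H] [InnerProductSpace ℂ H] [CompleteSpace H]

open scoped InnerProductSpace

theorem isOrthoProj_starProjection (M : Submodule ℂ H) [M.HasOrthogonalProjection] :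
    IsOrthoProj M.starProjection :=
  ⟨M.isIdempotentElem_starProjection, isSelfAdjoint_starProjection M⟩

theorem HasCR.opRank_corner {T : H →L[ℂ] H} (hT : HasCR T) {P : H →L[ℂ] H} (hP : IsOrthoProj P) :
    opRank ((1 - P) * T * P) = opRank ((1 - P) * star T * P) := by
  rw [← hP.complProj.corner_star, opRank_star]
  exact (hT P hP).symm

theorem hasCR_star {T : H →L[ℂ] H} (hT : HasCR T) : HasCR (star T) := by
  intro P hP
  have h := hT.opRank_corner hP
  change opRank _ = opRank _
  rw [← h, ← opRank_star, hP.complProj.corner_star, star_star]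

/-- Eigenvectors are reducing. -/
theorem HasCR.star_apply_eigenvector {T : H →L[ℂ] H} (hT : HasCR T) {x : H} {c : ℂ}
    (hx : T x = c • x) : star T x = (starRingEnd ℂ c) • x := by
  rcases eq_or_ne x 0 with rfl | hx0
  · simp
  set P := (ℂ ∙ x).starProjection with hPdef
  have hP : IsOrthoProj P := isOrthoProj_starProjection _
  have hPx : P x = x := Submodule.starProjection_eq_self_iff.2 (Submodule.mem_span_singleton_self x)
  have h0 : (1 - P) * T * P = 0 := by
    ext z
    obtain ⟨a, ha⟩ := Submodule.mem_span_singleton.1 ((ℂ ∙ x).starProjection_apply_mem z)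
    have ha : a • x = P z := ha
    simp [← ha, hx, hPx]
  have h1 : (1 - P) * star T * P = 0 := by
    refine opRank_eq_zero ?_
    rw [← hT.opRank_corner hP, h0, opRank_zero]
  have h2 : P (star T x) = star T x := by
    have := DFunLike.congr_fun h1 x
    exact (sub_eq_zero.1 (by simpa [hPx] using this)).symm
  obtain ⟨d, hd⟩ := Submodule.mem_span_singleton.1 (Submodule.starProjection_eq_self_iff.1 h2)
  have h3 := inner_star_right T x x
  rw [← hd, hx, inner_smul_left, inner_smul_right] at h3
  rw [← hd, mul_right_cancel₀ (inner_self_ne_zero.2 hx0) h3]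

theorem HasCR.apply_eigenvector_star {T : H →L[ℂ] H} (hT : HasCR T) {x : H} {c : ℂ}
    (hx : star T x = c • x) : T x = (starRingEnd ℂ c) • x := by
  simpa using (hasCR_star hT).star_apply_eigenvector hx

/-- The pointwise relation forced by equality of the ranks of the corners. -/
theorem HasCR.exists_relation_apply {T : H →L[ℂ] H} (hT : HasCR T) (x : H) :
    ∃ a b c d : ℂ, (a ≠ 0 ∨ b ≠ 0 ∨ c ≠ 0 ∨ d ≠ 0) ∧
      a • x + b • T x + c • star T x + d • star T (T x) = 0 := by
  set M := Submodule.span ℂ {x, T x} with hM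
  have : FiniteDimensional ℂ M := FiniteDimensional.span_of_finite ℂ (by simp)
  set P := M.starProjection with hPdef
  have hP : IsOrthoProj P := isOrthoProj_starProjection _
  have hxM : x ∈ M := Submodule.subset_span (by simp)
  have hTxM : T x ∈ M := Submodule.subset_span (by simp)
  have hPx : P x = x := Submodule.starProjection_eq_self_iff.2 hxM
  have hPTx : P (T x) = T x := Submodule.starProjection_eq_self_iff.2 hTxM
  have h1 : opRank ((1 - P) * T * P) ≤ 1 := by
    refine (Submodule.rank_mono (t := ℂ ∙ ((1 - P) (T (T x)))) ?_).trans (rank_span_le _ |>.trans ?_)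
    · rintro _ ⟨z, rfl⟩
      obtain ⟨a, b, hab⟩ := Submodule.mem_span_pair.1 (M.starProjection_apply_mem z)
      have hab : a • x + b • T x = P z := hab
      refine Submodule.mem_span_singleton.2 ⟨b, ?_⟩
      simp [← hab, hPTx, smul_sub]
    · simp
  rw [hT.opRank_corner hP] at h1
  obtain ⟨v, -, hv⟩ := (rank_submodule_le_one_iff _).1 h1
  obtain ⟨s, hs⟩ := Submodule.mem_span_singleton.1 (hv ⟨x, rfl⟩)
  obtain ⟨t, ht⟩ := Submodule.mem_span_singleton.1 (hv ⟨T x, rfl⟩)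
  have hs : s • v = star T x - P (star T x) := by simpa [hPx] using hs
  have ht : t • v = star T (T x) - P (star T (T x)) := by simpa [hPTx] using ht
  obtain ⟨c, d, hcd, h⟩ : ∃ c d : ℂ, (c ≠ 0 ∨ d ≠ 0) ∧ c * s + d * t = 0 := by
    by_cases hs0 : s = 0
    · exact ⟨1, 0, by simp, by simp [hs0]⟩
    · exact ⟨-t, s, Or.inr hs0, by ring⟩
  have hmem : c • star T x + d • star T (T x) ∈ M := by
    have e : c • star T x + d • star T (T x) =
        P (c • star T x + d • star T (T x)) + (c * s + d * t) • v := by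
      rw [add_smul, mul_smul, mul_smul, hs, ht]
      simp [smul_sub]
      abel
    rw [h, zero_smul, add_zero] at e
    rw [e]
    exact M.starProjection_apply_mem _
  obtain ⟨a, b, hab⟩ := Submodule.mem_span_pair.1 hmem
  refine ⟨-a, -b, c, d, ?_, ?_⟩
  · tauto
  · rw [add_assoc, ← hab, neg_smul, neg_smul]; abel

end RankConsequences

section GlobalRelation

variable {H : Type*} [NormedAddCommGroup H] [InnerProductSpace ℂ H] [CompleteSpace H]

open scoped InnerProductSpace

/-- The vectors orthogonal to all eigenvectors of `T`. -/
def eigenOrthogonal (T : H →L[ℂ] H) : Submodule ℂ H where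
  carrier := {w | ∀ (μ : ℂ) (e : H), T e = μ • e → ⟪e, w⟫_ℂ = 0}
  zero_mem' := by intro μ e _; simp
  add_mem' := by
    intro v w hv hw μ e he
    rw [inner_add_right, hv μ e he, hw μ e he, add_zero]
  smul_mem' := by
    intro c w hw μ e he
    rw [inner_smul_right, hw μ e he, mul_zero]

theorem HasCR.eigenOrthogonal_eq_bot {T : H →L[ℂ] H} (hT : HasCR T)
    (hloc : ∀ w, ∃ N : Submodule ℂ H, FiniteDimensional ℂ N ∧ w ∈ N ∧ ∀ z ∈ N, T z ∈ N) :
    eigenOrthogonal T = ⊥ := by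
  by_contra hne
  obtain ⟨w, hw, hw0⟩ := Submodule.exists_mem_ne_zero_of_ne_bot hne
  obtain ⟨N, hN, hwN, hTN⟩ := hloc w
  have hinv : ∀ z ∈ N ⊓ eigenOrthogonal T, (T : H →ₗ[ℂ] H) z ∈ N ⊓ eigenOrthogonal T := by
    rintro z ⟨hz1, hz2⟩
    refine ⟨hTN z hz1, fun μ e he => ?_⟩
    have := inner_star_left T e z
    rw [hT.star_apply_eigenvector he, inner_smul_left, hz2 μ e he, mul_zero] at this
    exact this.symm
  have hfin : FiniteDimensional ℂ ↥(N ⊓ eigenOrthogonal T) :=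
    Submodule.finiteDimensional_of_le (S₂ := N) inf_le_left
  have hnt : Nontrivial ↥(N ⊓ eigenOrthogonal T) :=
    ⟨⟨⟨w, hwN, hw⟩, 0, fun h => hw0 (congrArg Subtype.val h)⟩⟩
  obtain ⟨c, hc⟩ := Module.End.exists_eigenvalue ((T : H →ₗ[ℂ] H).restrict hinv)
  obtain ⟨v, hv⟩ := hc.exists_hasEigenvector
  have h1 : T v = c • (v : H) := congrArg Subtype.val hv.apply_eq_smul
  have h2 := v.2.2 c v h1
  exact hv.2 (Subtype.ext (inner_self_eq_zero.1 h2))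

/-- If each vector lies in a finite-dimensional invariant subspace, the pointwise relations
can be chosen uniformly. -/
theorem HasCR.exists_relation_of_locally_finite {T : H →L[ℂ] H} (hT : HasCR T)
    (hloc : ∀ w, ∃ N : Submodule ℂ H, FiniteDimensional ℂ N ∧ w ∈ N ∧ ∀ z ∈ N, T z ∈ N) :
    ∃ a b c d : ℂ, (a ≠ 0 ∨ b ≠ 0 ∨ c ≠ 0 ∨ d ≠ 0) ∧
      a • 1 + b • T + c • star T + d • (star T * T) = 0 := by
  let v : ℂ → Fin 4 → ℂ := fun μ => ![1, μ, starRingEnd ℂ μ, μ * starRingEnd ℂ μ]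
  let Λ : Set ℂ := {μ | ∃ x, x ≠ 0 ∧ T x = μ • x}
  suffices hspan : Submodule.span ℂ (v '' Λ) < ⊤ by
    obtain ⟨f, hf0, hf⟩ := Submodule.exists_le_ker_of_lt_top _ hspan
    have hfs : ∀ u, f u = u 0 * f (Pi.single 0 1) + u 1 * f (Pi.single 1 1) +
        u 2 * f (Pi.single 2 1) + u 3 * f (Pi.single 3 1) := by
      intro u
      rw [LinearMap.pi_apply_eq_sum_univ f u, Fin.sum_univ_four]
      simp only [smul_eq_mul]
      congr! <;> simp [Pi.single_apply, eq_comm]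
    refine ⟨f (Pi.single 0 1), f (Pi.single 1 1), f (Pi.single 2 1), f (Pi.single 3 1), ?_, ?_⟩
    · by_contra! h
      obtain ⟨h0, h1, h2, h3⟩ := h
      exact hf0 (LinearMap.ext fun u => by rw [hfs, h0, h1, h2, h3]; simp)
    set X := f (Pi.single 0 1) • (1 : H →L[ℂ] H) + f (Pi.single 1 1) • T +
      f (Pi.single 2 1) • star T + f (Pi.single 3 1) • (star T * T) with hX
    have hXe : ∀ (μ : ℂ) (e : H), T e = μ • e → X e = 0 := by
      intro μ e he
      rcases eq_or_ne e 0 with rfl | he0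
      · simp
      have h1 : f (v μ) = 0 := hf (Submodule.subset_span ⟨μ, ⟨e, he0, he⟩, rfl⟩)
      rw [hfs] at h1
      have h2 : X e = f (v μ) • e := by
        rw [hfs]
        simp only [hX, add_apply, smul_apply, one_apply_eq_self, mul_apply_eq_comp, he,
          map_smul, hT.star_apply_eigenvector he, v]
        simp only [Matrix.cons_val]
        module
      rw [h2, hfs, h1, zero_smul]
    have hXs : star X = 0 := by
      ext w
      have : star X w ∈ eigenOrthogonal T := by
        intro μ e he
        rw [inner_star_right, hXe μ e he, inner_zero_left]
      rw [hT.eigenOrthogonal_eq_bot hloc] at this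
      simpa using this
    exact star_eq_zero.1 hXs
  refine lt_top_iff_ne_top.2 fun htop => ?_
  obtain ⟨g, hg1, hg2, hg3⟩ := Submodule.exists_fun_fin_finrank_span_eq ℂ (v '' Λ)
  choose μ hμ hμg using hg1
  choose x hx0 hx using hμ
  have hinj : Function.Injective μ := by
    intro i j hij
    refine hg3.injective ?_
    rw [← hμg, ← hμg, hij]
  have hli : LinearIndependent ℂ x :=
    Module.End.eigenvectors_linearIndependent' (T : H →ₗ[ℂ] H) μ hinj x fun i =>
      ⟨Module.End.mem_eigenspace_iff.2 (hx i), hx0 i⟩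
  obtain ⟨a, b, c, d, hne, hrel⟩ := hT.exists_relation_apply (∑ i, x i)
  have hsum : ∑ i, (a + b * μ i + c * starRingEnd ℂ (μ i) + d * (μ i * starRingEnd ℂ (μ i))) • x i
      = 0 := by
    rw [← hrel]
    simp only [map_sum, hx, map_smul, hT.star_apply_eigenvector (hx _), Finset.smul_sum,
      ← Finset.sum_add_distrib]
    refine Finset.sum_congr rfl fun i _ => ?_
    module
  have h0 := Fintype.linearIndependent_iff.1 hli _ hsum
  let f : (Fin 4 → ℂ) →ₗ[ℂ] ℂ := a • LinearMap.proj 0 + b • LinearMap.proj 1 +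
    c • LinearMap.proj 2 + d • LinearMap.proj 3
  have hf : f = 0 := by
    have : Submodule.span ℂ (Set.range g) ≤ LinearMap.ker f := by
      rw [Submodule.span_le]
      rintro _ ⟨i, rfl⟩
      rw [← hμg]
      simpa [f, v] using h0 i
    rw [hg2, htop] at this
    exact LinearMap.ext fun u => this Submodule.mem_top
  have ha := LinearMap.congr_fun hf (Pi.single 0 1)
  have hb := LinearMap.congr_fun hf (Pi.single 1 1)
  have hc := LinearMap.congr_fun hf (Pi.single 2 1)
  have hd := LinearMap.congr_fun hf (Pi.single 3 1)
  simp [f] at ha hb hc hd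
  simp [ha, hb, hc, hd] at hne

theorem locally_finite_of_quadratic_mem_finRk {T : H →L[ℂ] H} {a b c : ℂ}
    (hne : a ≠ 0 ∨ b ≠ 0 ∨ c ≠ 0) (hF : a • 1 + b • T + c • (T * T) ∈ finRk H) (w : H) :
    ∃ N : Submodule ℂ H, FiniteDimensional ℂ N ∧ w ∈ N ∧ ∀ z ∈ N, T z ∈ N := by
  set F := a • 1 + b • T + c • (T * T) with hFdef
  have hFap : ∀ x, F x = a • x + b • T x + c • T (T x) := fun x => by simp [hFdef]
  have hcomm : ∀ x, F (T x) = T (F x) := fun x => by simp [hFap]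
  have hF' : FiniteDimensional ℂ (LinearMap.range (F : H →ₗ[ℂ] H)) := hF
  have hfin : FiniteDimensional ℂ (Submodule.span ℂ {w, T w}) :=
    FiniteDimensional.span_of_finite ℂ (by simp)
  set N := Submodule.span ℂ {w, T w} ⊔ LinearMap.range (F : H →ₗ[ℂ] H) with hN
  have hw : w ∈ N := Submodule.mem_sup_left (Submodule.subset_span (by simp))
  have hTw : T w ∈ N := Submodule.mem_sup_left (Submodule.subset_span (by simp))
  have hFN : ∀ x, F x ∈ N := fun x => Submodule.mem_sup_right ⟨x, rfl⟩
  have hTTw : T (T w) ∈ N := by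
    by_cases hc : c = 0
    · by_cases hb : b = 0
      · have ha : a ≠ 0 := by tauto
        have : T (T w) = a⁻¹ • F (T (T w)) := by
          rw [hFap, hb, hc, zero_smul, zero_smul, add_zero, add_zero, inv_smul_smul₀ ha]
        rw [this]
        exact N.smul_mem _ (hFN _)
      · have : T (T w) = b⁻¹ • (F (T w) - a • T w) := by
          rw [hFap, hc, zero_smul, add_zero, add_sub_cancel_left, inv_smul_smul₀ hb]
        rw [this]
        exact N.smul_mem _ (N.sub_mem (hFN _) (N.smul_mem _ hTw))
    · have : T (T w) = c⁻¹ • (F w - (a • w + b • T w)) := by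
        rw [hFap, add_sub_cancel_left, inv_smul_smul₀ hc]
      rw [this]
      exact N.smul_mem _ (N.sub_mem (hFN _) (N.add_mem (N.smul_mem _ hw) (N.smul_mem _ hTw)))
  refine ⟨N, inferInstance, hw, fun z hz => ?_⟩
  obtain ⟨y, hy, _, ⟨u, rfl⟩, rfl⟩ := Submodule.mem_sup.1 hz
  obtain ⟨s, t, rfl⟩ := Submodule.mem_span_pair.1 hy
  rw [map_add, map_add, map_smul, map_smul]
  refine N.add_mem (N.add_mem (N.smul_mem _ hTw) (N.smul_mem _ hTTw)) ?_
  change T (F u) ∈ N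
  rw [← hcomm]
  exact hFN _

/-- Property (CR) forces a quadratic relation between `T` and its adjoint. -/
theorem HasCR.exists_relation [Nontrivial H] {T : H →L[ℂ] H} (hT : HasCR T) :
    ∃ a b c d : ℂ, (a ≠ 0 ∨ b ≠ 0 ∨ c ≠ 0 ∨ d ≠ 0) ∧
      a • 1 + b • T + c • star T + d • (star T * T) = 0 := by
  by_cases h1 : ∀ c : Fin 3 → ℂ, ∑ i, c i • (![1, T, star T] : Fin 3 → H →L[ℂ] H) i ∈ finRk H → c = 0
  · by_cases h2 : ∀ c : Fin 4 → ℂ,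
        ∑ i, c i • (![1, T, star T, star T * T] : Fin 4 → H →L[ℂ] H) i ∈ finRk H → c = 0
    · obtain ⟨x, -, hx⟩ := exists_linearIndependent_apply _ h2 (one_ne_zero (α := H →L[ℂ] H))
      obtain ⟨a, b, c, d, hne, hrel⟩ := hT.exists_relation_apply x
      have h := Fintype.linearIndependent_iff.1 hx ![a, b, c, d]
        (by simpa [Fin.sum_univ_four] using hrel)
      have ha : a = 0 := h 0
      have hb : b = 0 := h 1
      have hc : c = 0 := h 2
      have hd : d = 0 := h 3
      simp [ha, hb, hc, hd] at hne
    push Not at h2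
    obtain ⟨k, hk, hk0⟩ := h2
    simp only [Fin.sum_univ_four, Matrix.cons_val] at hk
    set F := k 0 • 1 + k 1 • T + k 2 • star T + k 3 • (star T * T) with hF
    have hFap : ∀ x, F x = k 0 • x + k 1 • T x + k 2 • star T x + k 3 • star T (T x) := fun x => by
      simp [hF]
    have hk3 : k 3 ≠ 0 := by
      intro h3
      have := h1 ![k 0, k 1, k 2] (by
        simpa [Fin.sum_univ_three, hF, h3] using hk)
      refine hk0 (funext fun i => ?_)
      fin_cases i
      · exact congrFun this 0
      · exact congrFun this 1
      · exact congrFun this 2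
      · exact h3
    by_cases hF0 : F = 0
    · exact ⟨k 0, k 1, k 2, k 3, by tauto, hF0⟩
    obtain ⟨x, hFx, hx⟩ := exists_linearIndependent_apply_mod _ h1 hk hF0
    obtain ⟨a, b, c, d, hne, hrel⟩ := hT.exists_relation_apply x
    have h := hx ![k 3 * a - d * k 0, k 3 * b - d * k 1, k 3 * c - d * k 2] (-d • x) (by
      simp only [Fin.sum_univ_three, Matrix.cons_val, map_smul, hFap, one_apply_eq_self]
      linear_combination (norm := module) (k 3) • hrel)
    have ha : k 3 * a - d * k 0 = 0 := congrFun h 0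
    have hb : k 3 * b - d * k 1 = 0 := congrFun h 1
    have hc : k 3 * c - d * k 2 = 0 := congrFun h 2
    have hd : d ≠ 0 := by
      rintro rfl
      simp [hk3] at ha hb hc
      simp [ha, hb, hc] at hne
    refine absurd ?_ hFx
    have h3 : d • F x = 0 := by
      rw [hFap]
      linear_combination (norm := module) (k 3) • hrel - ha • x - hb • T x - hc • star T x
    exact (smul_eq_zero.1 h3).resolve_left hd
  push Not at h1
  obtain ⟨k, hk, hk0⟩ := h1
  simp only [Fin.sum_univ_three, Matrix.cons_val] at hk
  set G := k 0 • 1 + k 1 • T + k 2 • star T with hG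
  have hGap : ∀ x, G x = k 0 • x + k 1 • T x + k 2 • star T x := fun x => by
    simp [hG]
  by_cases h3 : ∀ c : Fin 3 → ℂ, ∑ i, c i • (![1, T, T * T] : Fin 3 → H →L[ℂ] H) i ∈ finRk H → c = 0
  swap
  · push Not at h3
    obtain ⟨l, hl, hl0⟩ := h3
    simp only [Fin.sum_univ_three, Matrix.cons_val] at hl
    refine hT.exists_relation_of_locally_finite (locally_finite_of_quadratic_mem_finRk ?_ hl)
    by_contra! h
    refine hl0 (funext fun i => ?_)
    fin_cases i
    · exact h.1
    · exact h.2.1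
    · exact h.2.2
  have hk2 : k 2 ≠ 0 := by
    intro h2
    have := h3 ![k 0, k 1, 0] (by simpa [Fin.sum_univ_three, hG, h2] using hk)
    refine hk0 (funext fun i => ?_)
    fin_cases i
    · exact congrFun this 0
    · exact congrFun this 1
    · exact h2
  have hk1 : k 1 ≠ 0 := by
    intro h1
    have := h3 ![starRingEnd ℂ (k 0), starRingEnd ℂ (k 2), 0] (by
      simpa [Fin.sum_univ_three, hG, h1] using star_mem_finRk hk)
    have h2 : starRingEnd ℂ (k 2) = 0 := congrFun this 1
    exact hk2 (by simpa using h2)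
  by_cases hG0 : G = 0
  · exact ⟨k 0, k 1, k 2, 0, by tauto, by simpa using hG0⟩
  obtain ⟨x, hGx, hx⟩ := exists_linearIndependent_apply_mod _ h3 hk hG0
  obtain ⟨a, b, c, d, hne, hrel⟩ := hT.exists_relation_apply x
  have h := hx ![k 2 * a - c * k 0, k 2 * b - c * k 1 - d * k 0, -d * k 1] (-c • x - d • T x) (by
    simp only [Fin.sum_univ_three, Matrix.cons_val, map_smul, map_sub, hGap, one_apply_eq_self,
      mul_apply_eq_comp]
    linear_combination (norm := module) (k 2) • hrel)
  have ha : k 2 * a - c * k 0 = 0 := congrFun h 0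
  have hb : k 2 * b - c * k 1 - d * k 0 = 0 := congrFun h 1
  have hd : -d * k 1 = 0 := congrFun h 2
  have hd : d = 0 := by simpa [hk1] using hd
  subst hd
  have hc : c ≠ 0 := by
    rintro rfl
    simp [hk2] at ha hb
    simp [ha, hb] at hne
  refine absurd ?_ hGx
  have h4 : c • G x = 0 := by
    rw [hGap]
    linear_combination (norm := module) (k 2) • hrel - ha • x - hb • T x
  exact (smul_eq_zero.1 h4).resolve_left hc

end GlobalRelation

section ExactForm

variable {H : Type*} [NormedAddCommGroup H] [InnerProductSpace ℂ H] [CompleteSpace H]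

open scoped InnerProductSpace

theorem exists_selfAdjoint_of_real_relation {T : H →L[ℂ] H} {u r : ℂ} (hu : u ≠ 0)
    (hr : starRingEnd ℂ r = r) (h : u • T + starRingEnd ℂ u • star T = r • 1) :
    ∃ (l m : ℂ) (R : H →L[ℂ] H), star R = R ∧ T = l • R + m • 1 := by
  refine ⟨u⁻¹ * Complex.I, u⁻¹ * (r / 2), -Complex.I • (u • T - (r / 2) • 1), ?_, ?_⟩
  · have h1 : starRingEnd ℂ u • star T = r • 1 - u • T := by rw [← h]; abel
    simp only [star_smul, star_sub, star_one, RCLike.star_def, h1, map_neg, Complex.conj_I, map_div₀,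
      hr, map_ofNat]
    module
  · have e : u⁻¹ * Complex.I * -Complex.I = u⁻¹ := by
      rw [mul_assoc, mul_neg, Complex.I_mul_I]; ring
    rw [smul_smul, e, smul_sub, smul_smul, smul_smul, inv_mul_cancel₀ hu, one_smul]
    abel

theorem exists_selfAdjoint_of_linear_relation [Nontrivial H] {T : H →L[ℂ] H} {a b c : ℂ}
    (hne : a ≠ 0 ∨ b ≠ 0 ∨ c ≠ 0) (h : a • 1 + b • T + c • star T = 0) :
    ∃ (l m : ℂ) (R : H →L[ℂ] H), star R = R ∧ T = l • R + m • 1 := by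
  have hs : starRingEnd ℂ a • 1 + starRingEnd ℂ b • star T + starRingEnd ℂ c • T = 0 := by
    simpa using congrArg star h
  by_cases h1 : b + starRingEnd ℂ c = 0
  · by_cases h2 : Complex.I * (b - starRingEnd ℂ c) = 0
    · have h2 : b - starRingEnd ℂ c = 0 := by simpa using h2
      have hb : b = 0 := by linear_combination (h1 + h2) / 2
      have hc : c = 0 := by
        have : starRingEnd ℂ c = 0 := by linear_combination (h1 - h2) / 2
        simpa using this
      subst hb hc
      have ha : a = 0 := by simpa using h
      simp [ha] at hne
    · refine exists_selfAdjoint_of_real_relation h2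
        (r := -(Complex.I * (a - starRingEnd ℂ a))) (by simp; ring) ?_
      simp only [map_mul, map_sub, Complex.conj_I, Complex.conj_conj]
      linear_combination (norm := module) Complex.I • h - Complex.I • hs
  · refine exists_selfAdjoint_of_real_relation h1
      (r := -(a + starRingEnd ℂ a)) (by simp [add_comm]) ?_
    simp only [map_add, Complex.conj_conj]
    linear_combination (norm := module) h + hs

/-- An operator with property (CR) is an affine function of a selfadjoint operator or of a
unitary one. -/
theorem HasCR.exists_form [Nontrivial H] {T : H →L[ℂ] H} (hT : HasCR T) :
    (∃ (l m : ℂ) (R : H →L[ℂ] H), star R = R ∧ T = l • R + m • 1) ∨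
      ∃ (l m : ℂ) (V : H →L[ℂ] H), l ≠ 0 ∧ star V * V = 1 ∧ V * star V = 1 ∧ T = l • V + m • 1 := by
  obtain ⟨a, b, c, d, hne, hrel⟩ := hT.exists_relation
  by_cases hd : d = 0
  · subst hd
    exact Or.inl (exists_selfAdjoint_of_linear_relation (a := a) (b := b) (c := c) (by tauto)
      (by simpa using hrel))
  obtain ⟨α, β, γ, h⟩ : ∃ α β γ : ℂ, α • 1 + β • T + γ • star T + star T * T = 0 := by
    refine ⟨d⁻¹ * a, d⁻¹ * b, d⁻¹ * c, ?_⟩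
    have := congrArg (d⁻¹ • ·) hrel
    simpa [smul_smul, hd] using this
  have hs : starRingEnd ℂ α • 1 + starRingEnd ℂ β • star T + starRingEnd ℂ γ • T + star T * T = 0 := by
    simpa using congrArg star h
  by_cases hlin : α - starRingEnd ℂ α ≠ 0 ∨ β - starRingEnd ℂ γ ≠ 0 ∨ γ - starRingEnd ℂ β ≠ 0
  · refine Or.inl (exists_selfAdjoint_of_linear_relation hlin ?_)
    linear_combination (norm := module) h - hs
  push Not at hlin
  obtain ⟨hα, hβ, -⟩ := hlin
  have hβ : β = starRingEnd ℂ γ := sub_eq_zero.1 hβ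
  obtain ⟨α, rfl⟩ := Complex.conj_eq_iff_real.1 (sub_eq_zero.1 hα).symm
  set W := T + γ • 1 with hW
  set ρ : ℝ := ‖γ‖ ^ 2 - α with hρ
  have hWW : star W * W = (ρ : ℂ) • 1 := by
    have e : ((ρ : ℝ) : ℂ) = γ * starRingEnd ℂ γ - α := by
      rw [Complex.mul_conj, Complex.normSq_eq_norm_sq, hρ]; push_cast; ring
    rw [e]
    simp only [hW, star_add, star_smul, star_one, add_mul, mul_add, RCLike.star_def,
      smul_mul_assoc, mul_smul_comm, one_mul, mul_one]
    rw [hβ] at h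
    linear_combination (norm := module) h
  have hnorm : ∀ x, ‖W x‖ ^ 2 = ρ * ‖x‖ ^ 2 := by
    intro x
    have h1 := inner_star_right W x (W x)
    have h2 : star W (W x) = (ρ : ℂ) • x := by
      have := DFunLike.congr_fun hWW x
      simpa using this
    rw [h2, inner_smul_right, inner_self_eq_norm_sq_to_K, inner_self_eq_norm_sq_to_K] at h1
    apply Complex.ofReal_injective
    push_cast
    exact h1.symm
  have hTW : T = W + (-γ) • 1 := by rw [hW]; module
  rcases eq_or_ne ρ 0 with h0 | h0
  · left
    refine ⟨1, -γ, 0, star_zero _, ?_⟩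
    have : W = 0 := by
      ext x
      simpa [h0] using hnorm x
    rw [hTW, this]; simp
  right
  have hpos : 0 < ρ := by
    obtain ⟨x, hx⟩ := exists_ne (0 : H)
    have h1 := hnorm x
    have h2 : 0 < ‖x‖ ^ 2 := by positivity
    have h3 : 0 ≤ ρ * ‖x‖ ^ 2 := by rw [← h1]; positivity
    exact lt_of_le_of_ne (nonneg_of_mul_nonneg_left h3 h2) h0.symm
  set r : ℂ := ((Real.sqrt ρ : ℝ) : ℂ) with hr
  have hr0 : r ≠ 0 := by
    rw [hr]; exact_mod_cast (Real.sqrt_pos.2 hpos).ne'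
  have hrr : r * r = ρ := by
    rw [hr]; exact_mod_cast Real.mul_self_sqrt hpos.le
  have hrc : starRingEnd ℂ r = r := Complex.conj_ofReal _
  set V := r⁻¹ • W with hV
  have hWV : W = r • V := by rw [hV, smul_smul, mul_inv_cancel₀ hr0, one_smul]
  have hVV : star V * V = 1 := by
    rw [hV, star_smul, smul_mul_smul_comm, hWW, RCLike.star_def, map_inv₀, hrc, smul_smul, ← hrr]
    field_simp
    simp
  have hTV : T = r • V + (-γ) • 1 := by rw [← hWV]; exact hTW
  refine ⟨r, -γ, V, hr0, hVV, ?_, hTV⟩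
  have hinj : ∀ x, star V x = 0 → x = 0 := by
    intro x hx
    have h1 : star T x = (-starRingEnd ℂ γ) • x := by
      rw [hTV]
      simp [hx]
    have h2 := hT.apply_eigenvector_star h1
    rw [hTV] at h2
    have h3 : V x = 0 := by simpa [hr0] using h2
    have h4 := DFunLike.congr_fun hVV x
    simpa [h3] using h4.symm
  ext x
  refine sub_eq_zero.1 (hinj _ ?_)
  have h5 := DFunLike.congr_fun hVV (star V x)
  simp only [mul_apply_eq_comp, one_apply_eq_self] at h5 ⊢
  rw [map_sub, h5, sub_self]

end ExactForm

section ApproximateEigenvectors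

variable {H : Type*} [NormedAddCommGroup H] [InnerProductSpace ℂ H] [CompleteSpace H]

open scoped InnerProductSpace

theorem inner_apply_of_star_mul_self {V : H →L[ℂ] H} (hV : star V * V = 1) (x y : H) :
    ⟪V x, V y⟫_ℂ = ⟪x, y⟫_ℂ := by
  rw [← inner_star_right]
  have := DFunLike.congr_fun hV y
  exact congrArg _ this

theorem norm_apply_of_star_mul_self {V : H →L[ℂ] H} (hV : star V * V = 1) (x : H) :
    ‖V x‖ = ‖x‖ := by
  rw [norm_eq_sqrt_re_inner (𝕜 := ℂ), inner_apply_of_star_mul_self hV, ← norm_eq_sqrt_re_inner]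

theorem exists_approx_eigenvector_of_mem_spectrum {V : H →L[ℂ] H} (hV : star V * V = 1)
    (hV' : V * star V = 1) {μ : ℂ} (hμ : μ ∈ spectrum ℂ V) {ε : ℝ} (hε : 0 < ε) :
    ∃ f : H, ‖f‖ = 1 ∧ ‖V f - μ • f‖ ≤ ε := by
  by_contra! hcon
  have hbelow : ∀ x, ε * ‖x‖ ≤ ‖V x - μ • x‖ := by
    intro x
    rcases eq_or_ne x 0 with rfl | hx
    · simp
    have hx' : ‖x‖ ≠ 0 := norm_ne_zero_iff.2 hx
    have h := hcon (((‖x‖⁻¹ : ℝ) : ℂ) • x) (by simp [norm_smul, hx'])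
    rw [map_smul, smul_comm, ← smul_sub, norm_smul] at h
    simp only [Complex.ofReal_inv, norm_inv, Complex.norm_real, norm_norm] at h
    rw [inv_mul_eq_div, lt_div_iff₀ (by positivity)] at h
    exact h.le
  set W := V - μ • (1 : H →L[ℂ] H) with hW
  have hcomm : star W * W = W * star W := by
    simp only [hW, star_sub, star_smul, star_one, sub_mul, mul_sub, hV, hV', smul_mul_assoc,
      mul_smul_comm, one_mul, mul_one]
    module
  have hunit : IsUnit (star W * W) := by
    refine isUnit_of_coercive (c := ε ^ 2) (by positivity) fun x => ?_
    have h1 : ⟪(star W * W) x, x⟫_ℂ = ((‖W x‖ ^ 2 : ℝ) : ℂ) := by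
      rw [mul_apply_eq_comp, inner_star_left, inner_self_eq_norm_sq_to_K]
      push_cast; rfl
    rw [h1, Complex.ofReal_re]
    have h2 := hbelow x
    have h3 : W x = V x - μ • x := by simp [hW]
    rw [h3, ← mul_pow]
    gcongr
  have hWu : IsUnit W := (Commute.isUnit_mul_iff (show Commute (star W) W from hcomm)).1 hunit |>.2
  refine hμ ?_
  have : algebraMap ℂ (H →L[ℂ] H) μ - V = -W := by
    rw [hW, Algebra.algebraMap_eq_smul_one]; abel
  change IsUnit _
  rw [this]
  exact hWu.neg

theorem exists_unit_near {μ : ℂ} (hμ : ‖μ‖ = 1) {ε : ℝ} (hε : 0 < ε) :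
    ∃ ν : ℂ, ‖ν‖ = 1 ∧ ν ≠ μ ∧ ‖ν - μ‖ ≤ ε := by
  set t := min ε 1 with ht
  have ht0 : 0 < t := by positivity
  have ht1 : t ≤ 1 := min_le_right _ _
  have hexp : ‖Complex.exp (Complex.I * t) - 1‖ ≤ t := by
    simpa [abs_of_pos ht0] using Real.norm_exp_I_mul_ofReal_sub_one_le (x := t)
  refine ⟨μ * Complex.exp (Complex.I * t), ?_, ?_, ?_⟩
  · rw [norm_mul, hμ, one_mul, mul_comm, Complex.norm_exp_ofReal_mul_I]
  · intro h
    have hμ0 : μ ≠ 0 := by rintro rfl; simp at hμ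
    have h1 : Complex.exp (Complex.I * t) = 1 := mul_left_cancel₀ hμ0 (by rw [h, mul_one])
    have h2 := congrArg Complex.im h1
    rw [mul_comm, Complex.exp_ofReal_mul_I_im] at h2
    have h3 : 0 < Real.sin t := Real.sin_pos_of_pos_of_lt_pi ht0 (by linarith [Real.pi_gt_three])
    simp at h2
    linarith
  · have : μ * Complex.exp (Complex.I * t) - μ = μ * (Complex.exp (Complex.I * t) - 1) := by ring
    rw [this, norm_mul, hμ, one_mul]
    exact hexp.trans (min_le_left _ _)

/-- If the spectrum of a unitary is the whole circle, then approximate eigenvectors can be found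
orthogonal to any given finite set. -/
theorem exists_approx_eigenvector_orthogonal {V : H →L[ℂ] H} (hV : star V * V = 1)
    (hV' : V * star V = 1) (hσ : spectrum ℂ V = {z : ℂ | ‖z‖ = 1}) (s : Finset H) :
    ∀ (μ : ℂ), ‖μ‖ = 1 → ∀ ε : ℝ, 0 < ε →
      ∃ f : H, ‖f‖ = 1 ∧ (∀ e ∈ s, ⟪e, f⟫_ℂ = 0) ∧ ‖V f - μ • f‖ ≤ ε := by
  classical
  induction s using Finset.induction_on with
  | empty =>
    intro μ hμ ε hε
    obtain ⟨f, hf, hf'⟩ := exists_approx_eigenvector_of_mem_spectrum hV hV'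
      (show μ ∈ spectrum ℂ V by rw [hσ]; exact hμ) hε
    exact ⟨f, hf, by simp, hf'⟩
  | insert e s _ ih =>
    intro μ hμ ε hε
    obtain ⟨ν, hν, hne, hνμ⟩ := exists_unit_near hμ (show 0 < ε / 4 by positivity)
    set η := ‖ν - μ‖ with hη
    have hη0 : 0 < η := norm_pos_iff.2 (sub_ne_zero.2 hne)
    obtain ⟨f₁, hf₁, hs₁, hV₁⟩ := ih μ hμ (min (ε / 4) (η / 8)) (by positivity)
    obtain ⟨f₂, hf₂, hs₂, hV₂⟩ := ih ν hν (min (ε / 4) (η / 8)) (by positivity)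
    set δ := min (ε / 4) (η / 8) with hδ
    have hδ1 : δ ≤ ε / 4 := min_le_left _ _
    have hδ2 : δ ≤ η / 8 := min_le_right _ _
    have hinner : ‖⟪f₁, f₂⟫_ℂ‖ ≤ 1 / 4 := by
      have h1 : ⟪V f₁ - μ • f₁, V f₂⟫_ℂ + ⟪μ • f₁, V f₂ - ν • f₂⟫_ℂ =
          (1 - starRingEnd ℂ μ * ν) * ⟪f₁, f₂⟫_ℂ := by
        rw [inner_sub_left, inner_sub_right, inner_apply_of_star_mul_self hV,
          inner_smul_left, inner_smul_left, inner_smul_right]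
        ring
      have h2 : ‖1 - starRingEnd ℂ μ * ν‖ = η := by
        have hmm : starRingEnd ℂ μ * μ = 1 := by
          rw [mul_comm, Complex.mul_conj, Complex.normSq_eq_norm_sq, hμ]; simp
        have : 1 - starRingEnd ℂ μ * ν = -(starRingEnd ℂ μ * (ν - μ)) := by
          linear_combination -hmm
        rw [this, norm_neg, norm_mul, RCLike.norm_conj, hμ, one_mul]
      have h3 : η * ‖⟪f₁, f₂⟫_ℂ‖ ≤ δ + δ := by
        rw [← h2, ← norm_mul, ← h1]
        refine (norm_add_le _ _).trans (add_le_add ?_ ?_)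
        · refine (norm_inner_le_norm _ _).trans ?_
          rw [norm_apply_of_star_mul_self hV, hf₂, mul_one]; exact hV₁
        · refine (norm_inner_le_norm _ _).trans ?_
          rw [norm_smul, hμ, hf₁, one_mul, one_mul]; exact hV₂
      have h4 : η * ‖⟪f₁, f₂⟫_ℂ‖ ≤ η * (1 / 4) := by linarith
      exact le_of_mul_le_mul_left h4 hη0
    obtain ⟨a, b, hab, horth⟩ : ∃ a b : ℂ, (a ≠ 0 ∨ b ≠ 0) ∧ a * ⟪e, f₁⟫_ℂ + b * ⟪e, f₂⟫_ℂ = 0 := by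
      by_cases h0 : ⟪e, f₁⟫_ℂ = 0
      · exact ⟨1, 0, by simp, by simp [h0]⟩
      · exact ⟨-⟪e, f₂⟫_ℂ, ⟪e, f₁⟫_ℂ, Or.inr h0, by ring⟩
    set h := a • f₁ + b • f₂ with hh
    have hnorm : (‖a‖ + ‖b‖) ^ 2 ≤ 4 * ‖h‖ ^ 2 := by
      have h1 : ‖h‖ ^ 2 = ‖a‖ ^ 2 + 2 * (⟪a • f₁, b • f₂⟫_ℂ).re + ‖b‖ ^ 2 := by
        rw [hh, @norm_add_sq ℂ, norm_smul, norm_smul, hf₁, hf₂, mul_one, mul_one]; rfl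
      have h2 : |(⟪a • f₁, b • f₂⟫_ℂ).re| ≤ ‖a‖ * ‖b‖ * (1 / 4) := by
        refine (Complex.abs_re_le_norm _).trans ?_
        rw [inner_smul_left, inner_smul_right, norm_mul, norm_mul, RCLike.norm_conj, ← mul_assoc]
        gcongr
      have h3 := neg_le_of_abs_le h2
      rw [h1]
      nlinarith [sq_nonneg (‖a‖ - ‖b‖), sq_nonneg (‖a‖ + ‖b‖)]
    have hpos : 0 < ‖a‖ + ‖b‖ := by
      rcases hab with h0 | h0
      · have := norm_pos_iff.2 h0; positivity
      · have := norm_pos_iff.2 h0; positivity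
    have hh0 : 0 < ‖h‖ := by
      by_contra! hle
      have : ‖h‖ = 0 := le_antisymm hle (norm_nonneg _)
      rw [this] at hnorm
      nlinarith
    have hle2 : ‖a‖ + ‖b‖ ≤ 2 * ‖h‖ := by
      refine le_of_sq_le_sq ?_ (by positivity)
      nlinarith
    have hVh : ‖V h - μ • h‖ ≤ ε * ‖h‖ := by
      have e1 : V h - μ • h = a • (V f₁ - μ • f₁) + b • ((V f₂ - ν • f₂) + (ν - μ) • f₂) := by
        rw [hh, map_add, map_smul, map_smul]; module
      rw [e1]
      refine (norm_add_le _ _).trans ?_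
      rw [norm_smul, norm_smul]
      have h1 : ‖(V f₂ - ν • f₂) + (ν - μ) • f₂‖ ≤ ε / 2 := by
        refine (norm_add_le _ _).trans ?_
        rw [norm_smul, hf₂, mul_one]
        linarith
      have h2 : ‖a‖ * ‖V f₁ - μ • f₁‖ ≤ ‖a‖ * (ε / 2) := by gcongr; linarith
      have h3 : ‖b‖ * ‖(V f₂ - ν • f₂) + (ν - μ) • f₂‖ ≤ ‖b‖ * (ε / 2) := by gcongr
      nlinarith
    refine ⟨((‖h‖⁻¹ : ℝ) : ℂ) • h, ?_, ?_, ?_⟩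
    · simp [norm_smul, hh0.ne']
    · intro e' he'
      rw [inner_smul_right]
      have : ⟪e', h⟫_ℂ = 0 := by
        rw [hh, inner_add_right, inner_smul_right, inner_smul_right]
        rcases Finset.mem_insert.1 he' with rfl | he'
        · exact horth
        · rw [hs₁ _ he', hs₂ _ he']; simp
      rw [this, mul_zero]
    · rw [map_smul, smul_comm, ← smul_sub, norm_smul]
      simp only [Complex.ofReal_inv, norm_inv, Complex.norm_real, norm_norm]
      rw [inv_mul_eq_div, div_le_iff₀ hh0]
      exact hVh

theorem exists_orthonormal_seq_approx_eigenvector {V : H →L[ℂ] H} (hV : star V * V = 1)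
    (hV' : V * star V = 1) (hσ : spectrum ℂ V = {z : ℂ | ‖z‖ = 1})
    {μ : ℕ → ℂ} (hμ : ∀ n, ‖μ n‖ = 1) {ε : ℕ → ℝ} (hε : ∀ n, 0 < ε n) :
    ∃ f : ℕ → H, Orthonormal ℂ f ∧ ∀ n, ‖V (f n) - μ n • f n‖ ≤ ε n := by
  classical
  choose F hF1 hF2 hF3 using fun (s : Finset H) (n : ℕ) =>
    exists_approx_eigenvector_orthogonal hV hV' hσ s (μ n) (hμ n) (ε n) (hε n)
  let S : ℕ → Finset H := fun n => Nat.rec ∅ (fun n s => insert (F s n) s) n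
  have hS : ∀ n, S (n + 1) = insert (F (S n) n) (S n) := fun n => rfl
  have hmono : Monotone S := monotone_nat_of_le_succ fun n => by
    rw [hS]; exact Finset.subset_insert _ _
  have horth : ∀ i j, i < j → ⟪F (S i) i, F (S j) j⟫_ℂ = 0 := by
    intro i j hij
    refine hF2 _ _ _ (hmono (Nat.succ_le_of_lt hij) ?_)
    rw [Nat.succ_eq_add_one, hS]
    exact Finset.mem_insert_self _ _
  refine ⟨fun n => F (S n) n, ⟨fun n => hF1 _ _, fun i j hij => ?_⟩, fun n => hF3 _ _⟩
  rcases lt_or_gt_of_ne hij with h | h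
  · exact horth i j h
  · exact inner_eq_zero_symm.1 (horth j i h)

theorem exists_orthonormal_approx_eigenvector {ι : Type*} [Denumerable ι] {V : H →L[ℂ] H}
    (hV : star V * V = 1) (hV' : V * star V = 1) (hσ : spectrum ℂ V = {z : ℂ | ‖z‖ = 1})
    {μ : ι → ℂ} (hμ : ∀ n, ‖μ n‖ = 1) {ε : ι → ℝ} (hε : ∀ n, 0 < ε n) :
    ∃ f : ι → H, Orthonormal ℂ f ∧ ∀ n, ‖V (f n) - μ n • f n‖ ≤ ε n := by
  let q := Denumerable.eqv ι
  obtain ⟨f, hf, hf'⟩ := exists_orthonormal_seq_approx_eigenvector hV hV' hσ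
    (μ := μ ∘ q.symm) (fun n => hμ _) (ε := ε ∘ q.symm) (fun n => hε _)
  refine ⟨f ∘ q, hf.comp _ q.injective, fun n => ?_⟩
  simpa using hf' (q n)

end ApproximateEigenvectors

section HilbertSchmidt

variable {H : Type*} [NormedAddCommGroup H] [InnerProductSpace ℂ H] [CompleteSpace H]

open scoped InnerProductSpace

theorem isCompactOperator_smulRight (φ : H →L[ℂ] ℂ) (v : H) :
    IsCompactOperator ⇑(φ.smulRight v) :=
  (isCompactOperator_of_locallyCompactSpace_rng
    (ContinuousLinearMap.toSpanSingleton ℂ v)).comp_clm φ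

/-- Hilbert–Schmidt operators are compact. -/
theorem isCompactOperator_of_summable_hilbertBasis {ι : Type*} (b : HilbertBasis ι ℂ H)
    {A : H →L[ℂ] H} (hA : Summable fun i => ‖A (b i)‖ ^ 2) : IsCompactOperator ⇑A := by
  classical
  let F : Finset ι → H →L[ℂ] H := fun s => ∑ i ∈ s, (innerSL ℂ (b i)).smulRight (A (b i))
  have hFap : ∀ s x, F s x = ∑ i ∈ s, ⟪b i, x⟫_ℂ • A (b i) := by
    intro s x
    simp [F]
  have hFc : ∀ s, IsCompactOperator ⇑(F s) := by
    intro s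
    induction s using Finset.induction_on with
    | empty => simpa [F] using isCompactOperator_zero
    | insert i s hi ih =>
      have : F (insert i s) = (innerSL ℂ (b i)).smulRight (A (b i)) + F s := by
        simp only [F, Finset.sum_insert hi]
      rw [this]
      exact (isCompactOperator_smulRight _ _).add ih
  refine isCompactOperator_of_tendsto (F := F) (l := Filter.atTop) ?_ (Filter.Eventually.of_forall hFc)
  rw [Metric.tendsto_atTop]
  intro ε hε
  obtain ⟨s₀, hs₀⟩ := summable_iff_vanishing_norm.1 hA ((ε / 2) ^ 2) (by positivity)
  refine ⟨s₀, fun s hs => ?_⟩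
  rw [dist_eq_norm]
  refine lt_of_le_of_lt (ContinuousLinearMap.opNorm_le_bound _ (M := ε / 2) (by positivity) ?_)
    (by linarith)
  intro x
  have hsum : Filter.Tendsto (fun t => F t x) Filter.atTop (nhds (A x)) := by
    have h1 : HasSum (fun i => A (b.repr x i • b i)) (A x) := (b.hasSum_repr x).mapL A
    simp only [map_smul, b.repr_apply_apply] at h1
    simpa only [hFap, HasSum, SummationFilter.unconditional_filter] using h1
  have hlim : Filter.Tendsto (fun t => ‖F s x - F t x‖) Filter.atTop (nhds ‖F s x - A x‖) :=
    (tendsto_const_nhds.sub hsum).norm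
  refine le_of_tendsto hlim ?_
  filter_upwards [Filter.eventually_ge_atTop s] with t ht
  have e1 : F t x - F s x = ∑ i ∈ t \ s, ⟪b i, x⟫_ℂ • A (b i) := by
    rw [hFap, hFap, ← Finset.sum_sdiff ht, add_sub_cancel_right]
  rw [norm_sub_rev, e1]
  calc ‖∑ i ∈ t \ s, ⟪b i, x⟫_ℂ • A (b i)‖ ≤ ∑ i ∈ t \ s, ‖⟪b i, x⟫_ℂ‖ * ‖A (b i)‖ := by
        refine (norm_sum_le _ _).trans (le_of_eq ?_)
        simp only [norm_smul]
    _ ≤ √(∑ i ∈ t \ s, ‖⟪b i, x⟫_ℂ‖ ^ 2) * √(∑ i ∈ t \ s, ‖A (b i)‖ ^ 2) :=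
        Real.sum_mul_le_sqrt_mul_sqrt _ _ _
    _ ≤ ‖x‖ * (ε / 2) := by
        gcongr
        · refine Real.sqrt_le_iff.2 ⟨norm_nonneg _, ?_⟩
          exact b.orthonormal.sum_inner_products_le x
        · refine Real.sqrt_le_iff.2 ⟨by positivity, ?_⟩
          have := hs₀ (t \ s) (Finset.disjoint_of_subset_right hs Finset.sdiff_disjoint)
          exact (le_abs_self _).trans this.le
    _ = _ := mul_comm _ _

theorem isCompactOperator_of_summable_orthonormal {ι : Type*} {e : ι → H} (he : Orthonormal ℂ e)
    {A : H →L[ℂ] H} (h0 : ∀ w, (∀ i, ⟪e i, w⟫_ℂ = 0) → A w = 0)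
    (hA : Summable fun i => ‖A (e i)‖ ^ 2) : IsCompactOperator ⇑A := by
  obtain ⟨w, b, hw, hb⟩ := he.toSubtypeRange.exists_hilbertBasis_extension
  refine isCompactOperator_of_summable_hilbertBasis b ?_
  let g : ι → w := fun i => ⟨e i, hw ⟨i, rfl⟩⟩
  have hg : Function.Injective g := fun i j hij =>
    he.linearIndependent.injective (congrArg Subtype.val hij)
  refine (hg.summable_iff ?_).1 ?_
  · intro x hx
    have : A (b x) = 0 := by
      refine h0 _ fun i => ?_
      have h1 : e i = b (g i) := by rw [hb]
      rw [h1]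
      exact b.orthonormal.2 fun h => hx ⟨i, h⟩
    simp [this]
  · convert hA using 3 with i
    simp [hb, g]

theorem not_isCompactOperator_of_approx_orthonormal {A : H →L[ℂ] H} {x y : ℕ → H}
    (hx : ∀ n, ‖x n‖ = 1) (hy : Orthonormal ℂ y)
    (h : Filter.Tendsto (fun n => ‖A (x n) - y n‖) Filter.atTop (nhds 0)) :
    ¬ IsCompactOperator ⇑A := by
  intro hA
  obtain ⟨K, hK, hAK⟩ := hA.image_closedBall_subset_compact (f := (A : H →ₗ[ℂ] H)) 1
  obtain ⟨z, -, φ, hφ, hz⟩ := hK.tendsto_subseq (x := fun n => A (x n))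
    fun n => hAK ⟨x n, by simp [hx], rfl⟩
  have hyz : Filter.Tendsto (fun n => y (φ n)) Filter.atTop (nhds z) := by
    have h1 := tendsto_zero_iff_norm_tendsto_zero.2 (h.comp hφ.tendsto_atTop)
    simpa using hz.sub h1
  have hc := hyz.cauchySeq
  obtain ⟨N, hN⟩ := Metric.cauchySeq_iff'.1 hc 1 one_pos
  have h2 := hN (N + 1) (Nat.le_succ N)
  have h3 : ⟪y (φ (N + 1)), y (φ N)⟫_ℂ = 0 := hy.2 (hφ (Nat.lt_succ_self N)).ne'
  rw [dist_eq_norm] at h2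
  have h4 := @norm_sub_sq ℂ _ _ _ _ (y (φ (N + 1))) (y (φ N))
  rw [h3, hy.1, hy.1] at h4
  simp at h4
  nlinarith [norm_nonneg (y (φ (N + 1)) - y (φ N))]

/-- A subspace spanned by pseudo-orbits of `V`, with infinitely many starting points, has exactly
one compact corner. -/
theorem not_essentiallyReductive_of_pseudoOrbits {V : H →L[ℂ] H} {g : ℕ → ℕ → H}
    (hg : Orthonormal ℂ fun p : ℕ × ℕ => g p.1 p.2)
    (hsum : Summable fun p : ℕ × ℕ => ‖V (g p.1 p.2) - g p.1 (p.2 + 1)‖ ^ 2) :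
    ¬ EssentiallyReductive V := by
  intro hV
  set M := (Submodule.span ℂ (Set.range fun p : ℕ × ℕ => g p.1 (p.2 + 1))).topologicalClosure with hM
  have hcl : IsClosed (M : Set H) := Submodule.isClosed_topologicalClosure _
  have : CompleteSpace M := hcl.completeSpace_coe
  set P := M.starProjection with hPdef
  have hP : IsOrthoProj P := isOrthoProj_starProjection M
  have hgM : ∀ m k, g m (k + 1) ∈ M := fun m k =>
    Submodule.le_topologicalClosure _ (Submodule.subset_span ⟨(m, k), rfl⟩)
  have hPg : ∀ m k, P (g m (k + 1)) = g m (k + 1) := fun m k =>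
    Submodule.starProjection_eq_self_iff.2 (hgM m k)
  have hP0 : ∀ w, (∀ p : ℕ × ℕ, ⟪g p.1 (p.2 + 1), w⟫_ℂ = 0) → P w = 0 := by
    intro w hw
    refine (Submodule.starProjection_apply_eq_zero_iff M).2 ?_
    rw [hM, Submodule.orthogonal_closure]
    rw [Submodule.mem_orthogonal]
    intro u hu
    induction hu using Submodule.span_induction with
    | mem u hu => obtain ⟨p, rfl⟩ := hu; exact hw p
    | zero => simp
    | add u v _ _ h1 h2 => rw [inner_add_left, h1, h2, add_zero]
    | smul c u _ h1 => rw [inner_smul_left, h1, mul_zero]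
  have hnormP : ∀ x, ‖P x‖ ≤ ‖x‖ := fun x => M.norm_starProjection_apply_le x
  have hnormQ : ∀ x, ‖x - P x‖ ≤ ‖x‖ := by
    intro x
    have := hP.complProj.norm_sq x
    have h1 : (1 - P) x = x - P x := rfl
    rw [h1] at this
    refine le_of_sq_le_sq ?_ (norm_nonneg _)
    nlinarith [sq_nonneg ‖P x‖]
  have hc : IsCompactOperator ⇑((1 - P) * V * P) := by
    refine isCompactOperator_of_summable_orthonormal
      (e := fun p : ℕ × ℕ => g p.1 (p.2 + 1))
      (hg.comp (fun p : ℕ × ℕ => (p.1, p.2 + 1)) fun p q h => by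
        simpa [Prod.ext_iff] using h) ?_ ?_
    · intro w hw
      simp [hP0 w hw]
    · have hinj : Function.Injective fun p : ℕ × ℕ => (p.1, p.2 + 1) := fun p q h => by
        simpa [Prod.ext_iff] using h
      refine Summable.of_nonneg_of_le (fun p => by positivity) (fun p => ?_)
        (hsum.comp_injective hinj)
      simp only [Function.comp]
      have e : ((1 - P) * V * P) (g p.1 (p.2 + 1)) =
          (V (g p.1 (p.2 + 1)) - g p.1 (p.2 + 1 + 1)) -
            P (V (g p.1 (p.2 + 1)) - g p.1 (p.2 + 1 + 1)) := by
        simp only [mul_apply_eq_comp, hPg, sub_apply, one_apply_eq_self, map_sub]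
        abel
      rw [e]
      gcongr
      exact hnormQ _
  refine not_isCompactOperator_of_approx_orthonormal (x := fun m => g m 0) (y := fun m => g m 1)
    (fun m => hg.1 (m, 0)) (hg.comp (fun m : ℕ => (m, 1)) fun m n h => by
      simpa [Prod.ext_iff] using h) ?_ ((hV P hP).2 hc)
  have hP00 : ∀ m, P (g m 0) = 0 := fun m => hP0 _ fun p =>
    hg.2 (i := (p.1, p.2 + 1)) (j := (m, 0)) (by simp)
  have hinj : Function.Injective fun m : ℕ => (m, 0) := fun m n h => by
    simpa [Prod.ext_iff] using h
  have h1 := (hsum.comp_injective hinj).tendsto_atTop_zero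
  have h2 : Filter.Tendsto (fun m => ‖V (g m 0) - g m 1‖) Filter.atTop (nhds 0) := by
    have := h1.sqrt
    simpa [Function.comp_def, Real.sqrt_sq (norm_nonneg _)] using this
  refine squeeze_zero (fun _ => norm_nonneg _) (fun m => ?_) h2
  have e : (P * V * (1 - P)) (g m 0) - g m 1 = P (V (g m 0) - g m 1) := by
    simp [hP00, hPg]
  rw [e]
  exact hnormP _

end HilbertSchmidt

section PseudoOrbits

variable {H : Type*} [NormedAddCommGroup H] [InnerProductSpace ℂ H] [CompleteSpace H]

open scoped InnerProductSpace

/-- The normalized discrete Fourier transform of `f 0, …, f (N - 1)`. -/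
noncomputable def fourierVec (N : ℕ) (w : ℂ) (f : ℕ → H) (k : ℕ) : H :=
  ((√N : ℝ) : ℂ)⁻¹ • ∑ j ∈ Finset.range N, w ^ (j * k) • f j

theorem inner_fourierVec_eq_zero {N N' : ℕ} {w w' : ℂ} {f f' : ℕ → H}
    (h : ∀ i j, ⟪f i, f' j⟫_ℂ = 0) (k l : ℕ) :
    ⟪fourierVec N w f k, fourierVec N' w' f' l⟫_ℂ = 0 := by
  simp only [fourierVec, inner_smul_left, inner_smul_right, sum_inner, inner_sum, h, mul_zero,
    Finset.sum_const_zero]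

theorem inner_fourierVec_self {N : ℕ} {w : ℂ} (hw : ‖w‖ = 1) {f : ℕ → H} (hf : Orthonormal ℂ f)
    (k l : ℕ) : ⟪fourierVec N w f k, fourierVec N w f l⟫_ℂ =
      (N : ℂ)⁻¹ * ∑ j ∈ Finset.range N, (w ^ l * (w ^ k)⁻¹) ^ j := by
  have hN : ((√N : ℝ) : ℂ)⁻¹ * ((√N : ℝ) : ℂ)⁻¹ = (N : ℂ)⁻¹ := by
    rw [← mul_inv, ← Complex.ofReal_mul, Real.mul_self_sqrt (Nat.cast_nonneg N)]
    simp
  have hconj : (starRingEnd ℂ) w = w⁻¹ := (Complex.inv_eq_conj hw).symm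
  rw [fourierVec, fourierVec, inner_smul_left, inner_smul_right, hf.inner_sum, ← hN, mul_assoc]
  simp only [map_inv₀, Complex.conj_ofReal, map_pow, hconj]
  congr 2
  refine Finset.sum_congr rfl fun j _ => ?_
  rw [mul_pow, ← pow_mul, inv_pow, inv_pow, ← pow_mul, mul_comm l j, mul_comm k j, mul_comm]

theorem norm_fourierVec {N : ℕ} (hN : N ≠ 0) {w : ℂ} (hw : ‖w‖ = 1) {f : ℕ → H}
    (hf : Orthonormal ℂ f) (k : ℕ) : ‖fourierVec N w f k‖ = 1 := by
  have hw0 : w ≠ 0 := norm_ne_zero_iff.1 (by rw [hw]; exact one_ne_zero)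
  have h := inner_fourierVec_self (N := N) hw hf k k
  rw [mul_inv_cancel₀ (pow_ne_zero k hw0), inner_self_eq_norm_sq_to_K] at h
  simp only [one_pow, Finset.sum_const, Finset.card_range, nsmul_eq_mul, mul_one] at h
  rw [inv_mul_cancel₀ (Nat.cast_ne_zero.2 hN)] at h
  have h' : ‖fourierVec N w f k‖ ^ 2 = 1 :=
    Complex.ofReal_injective ((Complex.ofReal_pow _ _).trans (h.trans Complex.ofReal_one.symm))
  exact (pow_eq_one_iff_of_nonneg (norm_nonneg _) two_ne_zero).1 h'

theorem inner_fourierVec_of_ne {N : ℕ} {w : ℂ} (hw : IsPrimitiveRoot w N) {f : ℕ → H}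
    (hf : Orthonormal ℂ f) {k l : ℕ} (hk : k < N) (hl : l < N) (hkl : k ≠ l) :
    ⟪fourierVec N w f k, fourierVec N w f l⟫_ℂ = 0 := by
  have hN : N ≠ 0 := by omega
  have hw1 : ‖w‖ = 1 := hw.norm'_eq_one hN
  have hw0 : w ≠ 0 := norm_ne_zero_iff.1 (by rw [hw1]; exact one_ne_zero)
  rw [inner_fourierVec_self hw1 hf]
  have hz : w ^ l * (w ^ k)⁻¹ ≠ 1 := fun h => hkl <| by
    rw [mul_inv_eq_one₀ (pow_ne_zero k hw0)] at h
    exact (hw.pow_inj hl hk h).symm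
  have hzN : (w ^ l * (w ^ k)⁻¹) ^ N = 1 := by
    rw [mul_pow, inv_pow, ← pow_mul, ← pow_mul, mul_comm l, mul_comm k, pow_mul, pow_mul,
      hw.pow_eq_one]
    simp
  rw [geom_sum_eq hz, hzN, sub_self, zero_div, mul_zero]

theorem norm_apply_fourierVec_sub_le {V : H →L[ℂ] H} {N : ℕ} (hN : N ≠ 0) {w : ℂ} (hw : ‖w‖ = 1)
    {f : ℕ → H} (hf : ∀ j, ‖V (f j) - w ^ j • f j‖ ≤ ((N : ℝ) ^ 2)⁻¹) (k : ℕ) :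
    ‖V (fourierVec N w f k) - fourierVec N w f (k + 1)‖ ≤ (N : ℝ)⁻¹ := by
  have hN1 : (1 : ℝ) ≤ N := by exact_mod_cast Nat.one_le_iff_ne_zero.2 hN
  have e : V (fourierVec N w f k) - fourierVec N w f (k + 1) =
      ((√N : ℝ) : ℂ)⁻¹ • ∑ j ∈ Finset.range N, w ^ (j * k) • (V (f j) - w ^ j • f j) := by
    simp only [fourierVec, map_smul, map_sum]
    rw [← smul_sub, ← Finset.sum_sub_distrib]
    congr 1
    refine Finset.sum_congr rfl fun j _ => ?_
    rw [smul_sub, smul_smul, ← pow_add, mul_add, mul_one]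
  rw [e, norm_smul]
  have h1 : ‖((√N : ℝ) : ℂ)⁻¹‖ ≤ 1 := by
    rw [norm_inv, Complex.norm_real, Real.norm_of_nonneg (Real.sqrt_nonneg _)]
    exact inv_le_one_of_one_le₀ (Real.one_le_sqrt.2 hN1)
  have h2 : ‖∑ j ∈ Finset.range N, w ^ (j * k) • (V (f j) - w ^ j • f j)‖ ≤ (N : ℝ)⁻¹ := by
    refine (norm_sum_le _ _).trans ((Finset.sum_le_card_nsmul _ _ ((N : ℝ) ^ 2)⁻¹ ?_).trans ?_)
    · intro j _
      rw [norm_smul, norm_pow, hw, one_pow, one_mul]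
      exact hf j
    · rw [Finset.card_range, nsmul_eq_mul]
      refine le_of_eq ?_
      field_simp
  calc _ ≤ 1 * (N : ℝ)⁻¹ := mul_le_mul h1 h2 (norm_nonneg _) zero_le_one
    _ = _ := one_mul _

/-- The angle by which the gluing at time `k` has rotated from level `n` to level `n + 1`. -/
noncomputable def glueAngle (n k : ℕ) : ℝ := Real.pi / 2 * (k / 2 ^ n - 1)

/-- Gluing the cycles `c n` of length `2 ^ (n + 1)` into a single sequence. -/
noncomputable def glue (c : ℕ → ℕ → H) (k : ℕ) : H :=
  (Real.cos (glueAngle (Nat.log 2 k) k) : ℂ) • c (Nat.log 2 k) k +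
    (Real.sin (glueAngle (Nat.log 2 k) k) : ℂ) • c (Nat.log 2 k + 1) k

theorem glue_add_one (c : ℕ → ℕ → H) {k : ℕ} (hk : k ≠ 0) :
    glue c (k + 1) =
      (Real.cos (glueAngle (Nat.log 2 k) (k + 1)) : ℂ) • c (Nat.log 2 k) (k + 1) +
        (Real.sin (glueAngle (Nat.log 2 k) (k + 1)) : ℂ) • c (Nat.log 2 k + 1) (k + 1) := by
  have h1 : 2 ^ Nat.log 2 k ≤ k := Nat.pow_log_le_self 2 hk
  have h2 : k < 2 ^ (Nat.log 2 k + 1) := Nat.lt_pow_succ_log_self one_lt_two k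
  generalize Nat.log 2 k = n at h1 h2 ⊢
  rcases (show k + 1 ≤ 2 ^ (n + 1) from h2).lt_or_eq with h | h
  · have h3 : Nat.log 2 (k + 1) = n := Nat.log_eq_of_pow_le_of_lt_pow (by omega) h
    rw [glue, h3]
  · have h3 : Nat.log 2 (k + 1) = n + 1 := by rw [h, Nat.log_pow one_lt_two]
    have h4 : ((k + 1 : ℕ) : ℝ) = 2 ^ (n + 1) := by rw [h]; norm_num
    have a0 : glueAngle (n + 1) (k + 1) = 0 := by
      rw [glueAngle, h4, div_self (by positivity), sub_self, mul_zero]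
    have a1 : glueAngle n (k + 1) = Real.pi / 2 := by
      rw [glueAngle, h4, pow_succ]
      field_simp
      norm_num
    rw [glue, h3, a0, a1]
    simp

theorem norm_apply_glue_sub_le {V : H →L[ℂ] H} {c : ℕ → ℕ → H} (hc : ∀ n k, ‖c n k‖ = 1)
    (hV : ∀ n k, ‖V (c n k) - c n (k + 1)‖ ≤ ((2 : ℝ) ^ (n + 1))⁻¹) {k : ℕ} (hk : k ≠ 0) :
    ‖V (glue c k) - glue c (k + 1)‖ ≤ 10 / k := by
  have h2 : k < 2 ^ (Nat.log 2 k + 1) := Nat.lt_pow_succ_log_self one_lt_two k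
  rw [glue_add_one c hk, glue]
  generalize Nat.log 2 k = n at h2 ⊢
  set a := glueAngle n k with ha
  set b := glueAngle n (k + 1) with hb
  have hab : |a - b| = Real.pi / 2 * ((2 : ℝ) ^ n)⁻¹ := by
    have : a - b = -(Real.pi / 2 * ((2 : ℝ) ^ n)⁻¹) := by
      rw [ha, hb, glueAngle, glueAngle]
      push_cast
      ring
    rw [this, abs_neg, abs_of_pos (by positivity)]
  have e : V ((Real.cos a : ℂ) • c n k + (Real.sin a : ℂ) • c (n + 1) k) -
      ((Real.cos b : ℂ) • c n (k + 1) + (Real.sin b : ℂ) • c (n + 1) (k + 1)) =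
      (Real.cos a : ℂ) • (V (c n k) - c n (k + 1)) +
        (Real.sin a : ℂ) • (V (c (n + 1) k) - c (n + 1) (k + 1)) +
        ((Real.cos a - Real.cos b : ℝ) : ℂ) • c n (k + 1) +
        ((Real.sin a - Real.sin b : ℝ) : ℂ) • c (n + 1) (k + 1) := by
    simp only [map_add, map_smul, Complex.ofReal_sub]
    module
  rw [e]
  have hk0 : (0 : ℝ) < k := by exact_mod_cast Nat.pos_of_ne_zero hk
  have hk2 : (k : ℝ) ≤ 2 ^ n * 2 := by
    rw [← pow_succ]
    exact_mod_cast h2.le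
  have n1 : ‖(Real.cos a : ℂ) • (V (c n k) - c n (k + 1))‖ ≤ ((2 : ℝ) ^ n)⁻¹ * (1 / 2) := by
    rw [norm_smul, Complex.norm_real, Real.norm_eq_abs]
    calc _ ≤ 1 * ((2 : ℝ) ^ (n + 1))⁻¹ :=
          mul_le_mul (Real.abs_cos_le_one _) (hV _ _) (norm_nonneg _) zero_le_one
      _ = _ := by rw [pow_succ, mul_inv]; ring
  have n2 : ‖(Real.sin a : ℂ) • (V (c (n + 1) k) - c (n + 1) (k + 1))‖ ≤
      ((2 : ℝ) ^ n)⁻¹ * (1 / 4) := by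
    rw [norm_smul, Complex.norm_real, Real.norm_eq_abs]
    calc _ ≤ 1 * ((2 : ℝ) ^ (n + 1 + 1))⁻¹ :=
          mul_le_mul (Real.abs_sin_le_one _) (hV _ _) (norm_nonneg _) zero_le_one
      _ = _ := by rw [pow_succ, pow_succ, mul_inv, mul_inv]; ring
  have n3 : ‖((Real.cos a - Real.cos b : ℝ) : ℂ) • c n (k + 1)‖ ≤
      Real.pi / 2 * ((2 : ℝ) ^ n)⁻¹ := by
    rw [norm_smul, Complex.norm_real, Real.norm_eq_abs, hc, mul_one, ← hab]
    exact Real.abs_cos_sub_cos_le a b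
  have n4 : ‖((Real.sin a - Real.sin b : ℝ) : ℂ) • c (n + 1) (k + 1)‖ ≤
      Real.pi / 2 * ((2 : ℝ) ^ n)⁻¹ := by
    rw [norm_smul, Complex.norm_real, Real.norm_eq_abs, hc, mul_one, ← hab]
    exact Real.abs_sin_sub_sin_le a b
  have hpi : Real.pi / 2 * ((2 : ℝ) ^ n)⁻¹ ≤ 2 * ((2 : ℝ) ^ n)⁻¹ := by
    have := Real.pi_le_four
    gcongr
    linarith
  have hfin : 5 * ((2 : ℝ) ^ n)⁻¹ ≤ 10 / k := by
    rw [← div_eq_mul_inv, div_le_div_iff₀ (by positivity) hk0]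
    linarith
  have hpos : (0 : ℝ) < ((2 : ℝ) ^ n)⁻¹ := by positivity
  refine norm_add₄_le.trans ?_
  linarith

theorem inner_glue_eq_zero {c d : ℕ → ℕ → H} {k l : ℕ}
    (h : ∀ n n', k < 2 ^ (n + 1) → l < 2 ^ (n' + 1) → ⟪c n k, d n' l⟫_ℂ = 0) :
    ⟪glue c k, glue d l⟫_ℂ = 0 := by
  have hk : k < 2 ^ (Nat.log 2 k + 1) := Nat.lt_pow_succ_log_self one_lt_two k
  have hl : l < 2 ^ (Nat.log 2 l + 1) := Nat.lt_pow_succ_log_self one_lt_two l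
  have hk' : k < 2 ^ (Nat.log 2 k + 1 + 1) := by rw [pow_succ]; omega
  have hl' : l < 2 ^ (Nat.log 2 l + 1 + 1) := by rw [pow_succ]; omega
  simp only [glue, inner_add_left, inner_add_right, inner_smul_left, inner_smul_right,
    h _ _ hk hl, h _ _ hk hl', h _ _ hk' hl, h _ _ hk' hl', mul_zero, add_zero]

theorem norm_glue {c : ℕ → ℕ → H} (hc : ∀ n k, ‖c n k‖ = 1) {k : ℕ}
    (h : ∀ n n', n ≠ n' → k < 2 ^ (n + 1) → k < 2 ^ (n' + 1) → ⟪c n k, c n' k⟫_ℂ = 0) :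
    ‖glue c k‖ = 1 := by
  have hk : k < 2 ^ (Nat.log 2 k + 1) := Nat.lt_pow_succ_log_self one_lt_two k
  have hk' : k < 2 ^ (Nat.log 2 k + 1 + 1) := by rw [pow_succ]; omega
  have hi := h _ _ (Nat.lt_succ_self (Nat.log 2 k)).ne hk hk'
  refine (pow_eq_one_iff_of_nonneg (norm_nonneg _) two_ne_zero).1 ?_
  rw [glue, sq, norm_add_sq_eq_norm_sq_add_norm_sq_of_inner_eq_zero (𝕜 := ℂ)]
  · simp only [norm_smul, hc, Complex.norm_real, mul_one, Real.norm_eq_abs, abs_mul_abs_self]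
    rw [← sq, ← sq, Real.cos_sq_add_sin_sq]
  · rw [inner_smul_left, inner_smul_right, hi, mul_zero, mul_zero]

theorem summable_inv_four_pow_add_sq :
    Summable fun p : ℕ × ℕ => (((4 : ℝ) ^ p.1 + p.2) ^ 2)⁻¹ := by
  have h1 : Summable fun m : ℕ => ((1 : ℝ) / 2) ^ m := summable_geometric_two
  have h2 : Summable fun i : ℕ => 1 / ((i + 1 : ℕ) : ℝ) ^ (3 / 2 : ℝ) :=
    (summable_nat_add_iff 1).2 (Real.summable_one_div_nat_rpow.2 (by norm_num))
  refine Summable.of_nonneg_of_le (fun p => by positivity) (fun p => ?_)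
    (h1.mul_of_nonneg h2 (fun _ => by positivity) fun _ => by positivity)
  obtain ⟨m, i⟩ := p
  have h4 : (1 : ℝ) ≤ 4 ^ m := one_le_pow₀ (by norm_num)
  have hx : (0 : ℝ) < 4 ^ m + i := by positivity
  simp only
  rw [one_div_pow, one_div_mul_one_div, ← one_div]
  refine one_div_le_one_div_of_le (by positivity) ?_
  have e : ((4 : ℝ) ^ m + i) ^ 2 = (4 ^ m + i) ^ (1 / 2 : ℝ) * (4 ^ m + i) ^ (3 / 2 : ℝ) := by
    rw [← Real.rpow_add hx]
    norm_num
  rw [e]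
  have e2 : (2 : ℝ) ^ m = (4 ^ m) ^ (1 / 2 : ℝ) := by
    rw [← Real.sqrt_eq_rpow, show (4 : ℝ) = 2 ^ 2 by norm_num, ← pow_mul, mul_comm, pow_mul,
      Real.sqrt_sq (by positivity)]
  rw [e2]
  gcongr
  · linarith [(Nat.cast_nonneg i : (0 : ℝ) ≤ i)]
  · push_cast
    linarith

theorem not_essentiallyReductive_of_spectrum_eq_circle {V : H →L[ℂ] H} (hV : star V * V = 1)
    (hV' : V * star V = 1) (hσ : spectrum ℂ V = {z : ℂ | ‖z‖ = 1}) : ¬ EssentiallyReductive V := by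
  let N : ℕ → ℕ := fun n => 2 ^ (n + 1)
  have hN : ∀ n, N n ≠ 0 := fun n => pow_ne_zero _ two_ne_zero
  let w : ℕ → ℂ := fun n => Complex.exp (2 * Real.pi * Complex.I / N n)
  have hw : ∀ n, IsPrimitiveRoot (w n) (N n) := fun n => Complex.isPrimitiveRoot_exp _ (hN n)
  have hw1 : ∀ n, ‖w n‖ = 1 := fun n => (hw n).norm'_eq_one (hN n)
  obtain ⟨f, hf, hfV⟩ := exists_orthonormal_approx_eigenvector (ι := ℕ × ℕ × ℕ) hV hV' hσ
    (μ := fun q => w q.2.1 ^ q.2.2) (fun q => by rw [norm_pow, hw1, one_pow])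
    (ε := fun q => ((N q.2.1 : ℝ) ^ 2)⁻¹)
    (fun q => inv_pos.2 (pow_pos (Nat.cast_pos.2 (Nat.pos_of_ne_zero (hN _))) _))
  have hf' : ∀ m n, Orthonormal ℂ fun j => f (m, n, j) := fun m n =>
    hf.comp (fun j => (m, n, j)) fun i j h => by simpa using h
  let c : ℕ → ℕ → ℕ → H := fun m n => fourierVec (N n) (w n) fun j => f (m, n, j)
  have hc1 : ∀ m n k, ‖c m n k‖ = 1 := fun m n => norm_fourierVec (hN n) (hw1 n) (hf' m n)
  have hc0 : ∀ m n m' n' k l, (m, n) ≠ (m', n') → ⟪c m n k, c m' n' l⟫_ℂ = 0 :=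
    fun m n m' n' k l h => inner_fourierVec_eq_zero (fun i j => hf.2 fun h' => h (by
      simp only [Prod.mk.injEq] at h' ⊢
      exact ⟨h'.1, h'.2.1⟩)) k l
  have hcV : ∀ m n k, ‖V (c m n k) - c m n (k + 1)‖ ≤ ((2 : ℝ) ^ (n + 1))⁻¹ := by
    intro m n k
    have := norm_apply_fourierVec_sub_le (hN n) (hw1 n) (fun j => hfV (m, n, j)) k
    simpa only [N, Nat.cast_pow, Nat.cast_ofNat] using this
  refine not_essentiallyReductive_of_pseudoOrbits (g := fun m i => glue (c m) (4 ^ m + i)) ?_ ?_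
  · refine ⟨fun p => norm_glue (hc1 _) fun n n' h _ _ => hc0 _ _ _ _ _ _ (by simpa using h), ?_⟩
    rintro ⟨m, i⟩ ⟨m', i'⟩ hne
    refine inner_glue_eq_zero fun n n' hk hl => ?_
    by_cases h : (m, n) = (m', n')
    · obtain ⟨rfl, rfl⟩ := Prod.mk.inj h
      exact inner_fourierVec_of_ne (hw n) (hf' m n) hk hl fun h => hne (by simpa using h)
    · exact hc0 _ _ _ _ _ _ h
  · refine Summable.of_nonneg_of_le (fun p => by positivity) (fun p => ?_)
      (summable_inv_four_pow_add_sq.mul_left 100)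
    have h := norm_apply_glue_sub_le (V := V) (hc1 p.1) (hcV p.1) (k := 4 ^ p.1 + p.2)
      (by positivity)
    calc _ ≤ (10 / ((4 ^ p.1 + p.2 : ℕ) : ℝ)) ^ 2 := pow_le_pow_left₀ (norm_nonneg _) h 2
      _ = _ := by
        rw [div_pow, div_eq_mul_inv]
        push_cast
        norm_num

end PseudoOrbits

theorem EssentiallyReductive.of_smul_add {H : Type*} [NormedAddCommGroup H]
    [InnerProductSpace ℂ H] [CompleteSpace H] {V : H →L[ℂ] H} {a b : ℂ} (ha : a ≠ 0)
    (h : EssentiallyReductive (a • V + b • 1)) : EssentiallyReductive V := by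
  intro P hP
  have := h P hP
  rwa [corner_smul_add P V hP.1, corner_smul_add' P V hP.1, isCompactOperator_smul_clm ha,
    isCompactOperator_smul_clm ha] at this

theorem stmt19 {H : Type*} [NormedAddCommGroup H] [InnerProductSpace ℂ H]
    [CompleteSpace H] [TopologicalSpace.SeparableSpace H]
    (hinf : ¬ FiniteDimensional ℂ H) (T : H →L[ℂ] H) :
    (EssentiallyReductive T ∧ HasCR T) ↔
      ((∃ (fl mu : ℂ) (R : H →L[ℂ] H), ContinuousLinearMap.adjoint R = R ∧
          T = fl • R + mu • 1) ∨
       (∃ (fl mu : ℂ) (V : H →L[ℂ] H),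
          ContinuousLinearMap.adjoint V * V = 1 ∧ V * ContinuousLinearMap.adjoint V = 1 ∧
          spectrum ℂ V ≠ {z : ℂ | ‖z‖ = 1} ∧
          T = fl • V + mu • 1)) := by
  constructor
  · rintro ⟨hE, hCR⟩
    have : Nontrivial H := by
      by_contra h
      have := not_nontrivial_iff_subsingleton.1 h
      exact hinf inferInstance
    rcases hCR.exists_form with ⟨l, m, R, hR, rfl⟩ | ⟨l, m, V, hl, hV, hV', rfl⟩
    · exact Or.inl ⟨l, m, R, hR, rfl⟩
    · exact Or.inr ⟨l, m, V, hV, hV', fun hσ =>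
        not_essentiallyReductive_of_spectrum_eq_circle hV hV' hσ (hE.of_smul_add hl), rfl⟩
  · rintro (⟨l, m, R, hR, rfl⟩ | ⟨l, m, V, hV, hV', hσ, rfl⟩)
    · exact essentiallyReductive_and_hasCR_of_corners _ _ fun P hP => selfAdjoint_corners hR hP
    · exact essentiallyReductive_and_hasCR_of_unitary hV hV' hσ l m
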